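/- arXiv:1608.03574 — 10 statements merged into one kernel-verified Lean document; each statement's English description precedes it below -/
import Mathlib

section
/- Let G be a bipartite graph with vertex classes U and W where U and W are nonempty, |U| + |W| = m^2 for a positive integer m, m divides |U|, and every vertex has degree at most d (with d ≥ 1). Then there exist a partition S_1, …, S_m of U and a partition T_1, …, T_m of W such that every S_i and every T_j has size at most 2m, and for all i, j the number of edges of G with one endpoint in S_i and the other in T_j is at most 2d^2. -/
open Finset

section Bimatrix

variable {I J : Type*} [Fintype I] [Fintype J]

/-- A mixed strategy: a probability distribution on a finite type. -/
def IsDist (x : I → ℝ) : Prop := (∀ i, 0 ≤ x i) ∧ ∑ i, x i = 1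

/-- Expected payoff `xᵀ M y`. -/
noncomputable def pay (M : I → J → ℝ) (x : I → ℝ) (y : J → ℝ) : ℝ :=
  ∑ i, ∑ j, x i * M i j * y j

/-- `(M y)_i`, the payoff of pure row `i` against mixed strategy `y`. -/
noncomputable def rowPay (M : I → J → ℝ) (y : J → ℝ) (i : I) : ℝ := ∑ j, M i j * y j

/-- `(xᵀ M)_j`, the payoff of pure column `j` against mixed strategy `x`. -/
noncomputable def colPay (M : I → J → ℝ) (x : I → ℝ) (j : J) : ℝ := ∑ i, x i * M i j

/-- Social welfare. -/
noncomputable def sw (R C : I → J → ℝ) (x : I → ℝ) (y : J → ℝ) : ℝ := pay R x y + pay C x y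

/-- `(x,y)` is an ε-approximate Nash equilibrium of the bimatrix game `(R,C)`. -/
def IsEpsNE (R C : I → J → ℝ) (x : I → ℝ) (y : J → ℝ) (ε : ℝ) : Prop :=
  IsDist x ∧ IsDist y ∧
  (∀ i, rowPay R y i - pay R x y ≤ ε) ∧
  (∀ j, colPay C x j - pay C x y ≤ ε)

/-- `(x,y)` is an ε-well-supported Nash equilibrium of `(R,C)`. -/
def IsEpsWSNE (R C : I → J → ℝ) (x : I → ℝ) (y : J → ℝ) (ε : ℝ) : Prop :=
  IsDist x ∧ IsDist y ∧
  (∀ i, 0 < x i → ∀ k, rowPay R y k - rowPay R y i ≤ ε) ∧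
  (∀ j, 0 < y j → ∀ k, colPay C x k - colPay C x j ≤ ε)

end Bimatrix

/-- ℓ₁ norm of a finitely-indexed real vector. -/
noncomputable def l1 {I : Type*} [Fintype I] (v : I → ℝ) : ℝ := ∑ i, |v i|

section FreeGame

variable {X Y A B : Type*} [Fintype X] [Fintype Y] [Fintype A] [Fintype B]

/-- Payoff of a strategy pair in the free game with verifier `V`. -/
noncomputable def freePayoff (V : X → Y → A → B → ℝ) (s₁ : X → A) (s₂ : Y → B) : ℝ :=
  (1 / ((Fintype.card X : ℝ) * (Fintype.card Y : ℝ))) * ∑ x, ∑ y, V x y (s₁ x) (s₂ y)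

/-- Value `ω(F)` of the free game: the best payoff over all strategy pairs. -/
noncomputable def gameValue [Nonempty A] [Nonempty B] (V : X → Y → A → B → ℝ) : ℝ :=
  ⨆ s : (X → A) × (Y → B), freePayoff V s.1 s.2

end FreeGame

/-- Functions selecting exactly half of the elements of a finite type. -/
abbrev HalfFns (Y : Type*) [Fintype Y] : Type _ :=
  {f : Y → Bool // 2 * (Finset.univ.filter (fun y => f y = true)).card = Fintype.card Y}

section GGame

variable {X Y A B : Type*} [Fintype X] [Fintype Y] [Fintype A] [Fintype B]

/-- Row player's payoffs in the game `G(F,g,δ)`. -/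
noncomputable def GRow (V : X → Y → A → B → ℝ) (g δ : ℝ) :
    X × A ⊕ HalfFns Y → Y × B ⊕ HalfFns X → ℝ
  | Sum.inl (q, a), Sum.inl (r, b) => V q r a b
  | Sum.inr f, Sum.inl (r, _) => if f.1 r then 4 / (1 + 4 * g * δ) else 0
  | Sum.inl (q, _), Sum.inr f => -(if f.1 q then 4 / (1 + 4 * g * δ) else 0)
  | Sum.inr _, Sum.inr _ => 0

/-- Column player's payoffs in the game `G(F,g,δ)`. -/
noncomputable def GCol (V : X → Y → A → B → ℝ) (g δ : ℝ) :
    X × A ⊕ HalfFns Y → Y × B ⊕ HalfFns X → ℝ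
  | Sum.inl (q, a), Sum.inl (r, b) => V q r a b
  | Sum.inr f, Sum.inl (r, _) => -(if f.1 r then 4 / (1 + 4 * g * δ) else 0)
  | Sum.inl (q, _), Sum.inr f => if f.1 q then 4 / (1 + 4 * g * δ) else 0
  | Sum.inr _, Sum.inr _ => 0

/-- Question marginal of a row-player mixed strategy of `G(F,g,δ)`. -/
noncomputable def rowMarg (x : X × A ⊕ HalfFns Y → ℝ) (q : X) : ℝ := ∑ a, x (Sum.inl (q, a))

/-- Question marginal of a column-player mixed strategy of `G(F,g,δ)`. -/
noncomputable def colMarg (y : Y × B ⊕ HalfFns X → ℝ) (r : Y) : ℝ := ∑ b, y (Sum.inl (r, b))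

/-- Payoff of the two-prover game `T_{(x,y)}` with question distributions `x'`, `y'`. -/
noncomputable def tpPay (V : X → Y → A → B → ℝ) (x' : X → ℝ) (y' : Y → ℝ)
    (s₁ : X → A) (s₂ : Y → B) : ℝ :=
  ∑ q, ∑ r, x' q * y' r * V q r (s₁ q) (s₂ r)

/-- Row payoffs of the rescaled game `G_s(F,g,δ)`. -/
noncomputable def GsRow (V : X → Y → A → B → ℝ) (g δ : ℝ)
    (i : X × A ⊕ HalfFns Y) (j : Y × B ⊕ HalfFns X) : ℝ := (GRow V g δ i j + 4) / 8

/-- Column payoffs of the rescaled game `G_s(F,g,δ)`. -/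
noncomputable def GsCol (V : X → Y → A → B → ℝ) (g δ : ℝ)
    (i : X × A ⊕ HalfFns Y) (j : Y × B ⊕ HalfFns X) : ℝ := (GCol V g δ i j + 4) / 8

/-- Row payoffs of `G'(F)`, extending `G_s` by a new row `𝔦` and a new column `𝔧`
(the `Sum.inr` components); here `ε* = (1 - 4gδ)/8`. -/
noncomputable def G'Row (V : X → Y → A → B → ℝ) (g δ : ℝ) :
    (X × A ⊕ HalfFns Y) ⊕ Unit → (Y × B ⊕ HalfFns X) ⊕ Unit → ℝ
  | Sum.inl i, Sum.inl j => GsRow V g δ i j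
  | Sum.inr _, Sum.inl _ => 5 / 8 + (1 - 4 * g * δ) / 8
  | Sum.inl _, Sum.inr _ => 0
  | Sum.inr _, Sum.inr _ => 1

/-- Column payoffs of `G'(F)`. -/
noncomputable def G'Col (V : X → Y → A → B → ℝ) (g δ : ℝ) :
    (X × A ⊕ HalfFns Y) ⊕ Unit → (Y × B ⊕ HalfFns X) ⊕ Unit → ℝ
  | Sum.inl i, Sum.inl j => GsCol V g δ i j
  | Sum.inr _, Sum.inl _ => 0
  | Sum.inl _, Sum.inr _ => 5 / 8 + (1 - 4 * g * δ) / 8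
  | Sum.inr _, Sum.inr _ => 1

/-- Row payoffs of `G''(F)`, extending `G'` by a new row `𝔦'` and a new column `𝔧'`. -/
noncomputable def G''Row (V : X → Y → A → B → ℝ) (g δ : ℝ) :
    ((X × A ⊕ HalfFns Y) ⊕ Unit) ⊕ Unit → ((Y × B ⊕ HalfFns X) ⊕ Unit) ⊕ Unit → ℝ
  | Sum.inl i, Sum.inl j => G'Row V g δ i j
  | Sum.inr _, Sum.inl _ => 5 / 8
  | Sum.inl _, Sum.inr _ => 5 / 8
  | Sum.inr _, Sum.inr _ => 0

/-- Column payoffs of `G''(F)`. -/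
noncomputable def G''Col (V : X → Y → A → B → ℝ) (g δ : ℝ) :
    ((X × A ⊕ HalfFns Y) ⊕ Unit) ⊕ Unit → ((Y × B ⊕ HalfFns X) ⊕ Unit) ⊕ Unit → ℝ
  | Sum.inl i, Sum.inl j => G'Col V g δ i j
  | Sum.inr _, Sum.inl _ => 5 / 8
  | Sum.inl _, Sum.inr _ => 5 / 8
  | Sum.inr _, Sum.inr _ => 0

end GGame

section ClauseVar

variable {Vars : Type*}

/-- An assignment `α` satisfies a 3-clause `c` (a literal `(v, b)` stands for `v`
if `b = true` and for `¬v` if `b = false`). -/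
def SatClause (α : Vars → Bool) (c : Finset (Vars × Bool)) : Prop :=
  ∃ l ∈ c, α l.1 = l.2

open Classical in
/-- The verifier of the clause–variable free game associated to partitions
`S` of the variables and `T` of the clauses. -/
noncomputable def clauseVarV {m : ℕ} (S : Fin m → Finset Vars)
    (T : Fin m → Finset (Finset (Vars × Bool)))
    (i j : Fin m) (α β : Vars → Bool) : ℝ :=
  if (∀ c ∈ T j, SatClause β c) ∧
      (∀ v ∈ S i, (∃ c ∈ T j, ∃ p : Bool, (v, p) ∈ c) → α v = β v) then 1 else 0

end ClauseVar

/-- At most `#X / n` fibres of a map on `X` have at least `n` elements. -/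
theorem card_filter_le_card_fiber_mul_le {α κ : Type*} [Fintype κ] [DecidableEq κ]
    (X : Finset α) (t : α → κ) (n : ℕ) :
    #{j : κ | n ≤ #{x ∈ X | t x = j}} * n ≤ #X := by
  calc #{j : κ | n ≤ #{x ∈ X | t x = j}} * n
      ≤ ∑ j : κ with n ≤ #{x ∈ X | t x = j}, #{x ∈ X | t x = j} := by
        rw [← smul_eq_mul]
        exact card_nsmul_le_sum _ _ _ fun j hj => (mem_filter.1 hj).2
    _ ≤ ∑ j : κ, #{x ∈ X | t x = j} := sum_le_sum_of_subset (subset_univ _)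
    _ = #X := (card_eq_sum_card_fiberwise fun _ _ => mem_coe.2 (mem_univ _)).symm

/-- If at most `a * d` edges leave each class of `U`, a vertex of degree at most `d` has at most
`a` labels `j` for which some class adjacent to it already sends at least `d ^ 2` edges of `X`
to `j`. -/
theorem card_biUnion_filter_le_card_fiber_le {U W ι κ : Type*}
    [DecidableEq ι] [Fintype κ] [DecidableEq κ]
    (s : U → ι) (t : W → κ) (N X : Finset (U × W)) {a d : ℕ} (hd : 1 ≤ d)
    (hN : #N ≤ d) (hX : ∀ i, #{e ∈ X | s e.1 = i} ≤ a * d) :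
    #(N.biUnion fun f =>
      {j : κ | d ^ 2 ≤ #{e ∈ {e ∈ X | s e.1 = s f.1} | t e.2 = j}}) ≤ a := by
  refine (card_biUnion_le_card_mul _ _ (a / d) fun f _ => ?_).trans
    ((Nat.mul_le_mul_right _ hN).trans (Nat.mul_div_le a d))
  have h := (card_filter_le_card_fiber_mul_le {e ∈ X | s e.1 = s f.1}
    (fun e => t e.2) (d ^ 2)).trans (hX (s f.1))
  refine (Nat.le_div_iff_mul_le hd).2 (Nat.le_of_mul_le_mul_right ?_ hd)
  rwa [mul_assoc, ← sq]

/-- Given classes of `U` which at most `a * d` edges leave, `W` can be coloured with `a + b`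
colours so that each colour is used at most `k` times, where `#W ≤ b * k`, and at most `2 * d ^ 2`
edges join any class of `U` to any colour class. -/
theorem exists_balanced_coloring {U W ι κ : Type*} [Fintype W] [DecidableEq W]
    [DecidableEq ι] [Fintype κ] [DecidableEq κ]
    (s : U → ι) (E : Finset (U × W)) {a b d k : ℕ} (hd : 1 ≤ d)
    (hκ : a + b ≤ Fintype.card κ) (hb : 1 ≤ b) (hW : Fintype.card W ≤ b * k)
    (hdeg : ∀ w : W, #{e ∈ E | e.2 = w} ≤ d)
    (hE : ∀ i, #{e ∈ E | s e.1 = i} ≤ a * d) :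
    ∃ t : W → κ, (∀ j, #{w | t w = j} ≤ k) ∧
      ∀ i j, #{e ∈ E | s e.1 = i ∧ t e.2 = j} ≤ 2 * d ^ 2 := by
  suffices H : ∀ A : Finset W, ∃ t : W → κ, (∀ j, #{w ∈ A | t w = j} ≤ k) ∧
      ∀ i j, #{e ∈ {e ∈ {e ∈ E | e.2 ∈ A} | s e.1 = i} | t e.2 = j} ≤ 2 * d ^ 2 by
    simpa [filter_filter] using H univ
  intro A
  induction A using Finset.induction_on with
  | empty =>
    have : Nonempty κ := Fintype.card_pos_iff.1 (by omega)
    exact ⟨fun _ => Classical.arbitrary κ, by simp⟩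
  | insert w A hw ih =>
    obtain ⟨t, ht, hst⟩ := ih
    have hfull : #{j : κ | k ≤ #{x ∈ A | t x = j}} < b := by
      have h := card_filter_le_card_fiber_mul_le A t k
      have hA : #A < Fintype.card W := card_lt_univ_of_notMem hw
      exact Nat.lt_of_mul_lt_mul_right (h.trans_lt (hA.trans_le hW))
    have hheavy := card_biUnion_filter_le_card_fiber_le s t {e ∈ E | e.2 = w}
      {e ∈ E | e.2 ∈ A} hd (hdeg w) fun i =>
        (card_le_card (filter_subset_filter _ (filter_subset _ _))).trans (hE i)
    obtain ⟨j₀, -, hj₀⟩ := exists_mem_notMem_of_card_lt_card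
      (((card_union_le _ _).trans_lt (Nat.add_lt_add_of_le_of_lt hheavy hfull)).trans_le
        (hκ.trans_eq (card_univ (α := κ)).symm))
    simp only [mem_union, mem_biUnion, mem_filter, mem_univ, true_and, not_or, not_exists,
      not_and, not_le] at hj₀
    obtain ⟨hlight, hroom⟩ := hj₀
    have hne : ∀ x ∈ A, x ≠ w := fun x hx h => hw (h ▸ hx)
    refine ⟨Function.update t w j₀, fun j => ?_, fun i j => ?_⟩
    · have hsame : {x ∈ A | Function.update t w j₀ x = j} = {x ∈ A | t x = j} :=
        filter_congr fun x hx => by rw [Function.update_of_ne (hne x hx)]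
      rw [filter_insert, Function.update_self, hsame]
      split_ifs with h
      · subst h
        exact (card_insert_le _ _).trans hroom
      · exact ht j
    · by_cases h : j = j₀ ∧ ∃ f ∈ E, f.2 = w ∧ s f.1 = i
      · obtain ⟨rfl, f, hf, hfw, rfl⟩ := h
        have hsub : {e ∈ {e ∈ {e ∈ E | e.2 ∈ insert w A} | s e.1 = s f.1} |
            Function.update t w j e.2 = j} ⊆
            ({e ∈ {e ∈ {e ∈ E | e.2 ∈ A} | s e.1 = s f.1} | t e.2 = j}).disjUnion
              {e ∈ E | e.2 = w} (disjoint_left.2 fun e he he' => by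
                simp only [mem_filter] at he he'
                exact hne _ he.1.1.2 he'.2) := by
          intro e he
          simp only [mem_filter, mem_insert, mem_disjUnion] at he ⊢
          by_cases hew : e.2 = w
          · exact Or.inr ⟨he.1.1.1, hew⟩
          · rw [Function.update_of_ne hew] at he
            tauto
        refine (card_le_card hsub).trans ?_
        rw [card_disjUnion]
        have h₁ := hlight f ⟨hf, hfw⟩
        have h₂ := hdeg w
        nlinarith
      · refine (card_le_card fun e he => ?_).trans (hst i j)
        simp only [mem_filter, mem_insert] at he ⊢
        by_cases hew : e.2 = w
        · rw [hew, Function.update_self] at he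
          exact absurd ⟨he.2.symm, e, he.1.1.1, hew, he.1.2⟩ h
        · rw [Function.update_of_ne hew] at he
          tauto

/-- a bipartite graph (edge set `E ⊆ U × W`) with `|U| + |W| = m²`,
`m ∣ |U|` and maximum degree `d` can be split into partitions `S₁,…,S_m` of `U`
and `T₁,…,T_m` of `W` with parts of size at most `2m` and at most `2d²` edges
between any `S_i` and `T_j`. -/
theorem bipartite_partition {U W : Type*} [Fintype U] [Fintype W]
    [DecidableEq U] [DecidableEq W] [Nonempty U] [Nonempty W]
    (m d : ℕ) (hm : 0 < m) (hd : 1 ≤ d)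
    (hcard : Fintype.card U + Fintype.card W = m ^ 2)
    (hdvd : m ∣ Fintype.card U)
    (E : Finset (U × W))
    (hdegU : ∀ u : U, (E.filter (fun e => e.1 = u)).card ≤ d)
    (hdegW : ∀ w : W, (E.filter (fun e => e.2 = w)).card ≤ d) :
    ∃ (S : Fin m → Finset U) (T : Fin m → Finset W),
      (∀ i j, i ≠ j → Disjoint (S i) (S j)) ∧ (∀ u : U, ∃ i, u ∈ S i) ∧
      (∀ i j, i ≠ j → Disjoint (T i) (T j)) ∧ (∀ w : W, ∃ j, w ∈ T j) ∧
      (∀ i, (S i).card ≤ 2 * m) ∧ (∀ j, (T j).card ≤ 2 * m) ∧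
      (∀ i j, (E.filter (fun e => e.1 ∈ S i ∧ e.2 ∈ T j)).card ≤ 2 * d ^ 2) := by
  obtain ⟨a, ha⟩ := hdvd
  have hU : 0 < Fintype.card U := Fintype.card_pos
  have hW : 0 < Fintype.card W := Fintype.card_pos
  have ham : a < m := by
    refine Nat.lt_of_mul_lt_mul_left (a := m) ?_
    rw [← ha, ← sq]
    omega
  obtain ⟨b, rfl⟩ := Nat.exists_eq_add_of_lt ham
  have hWcard : Fintype.card W = (b + 1) * (a + b + 1) := by
    rw [ha] at hcard
    nlinarith
  let φ : U ≃ Fin (a + b + 1) × Fin a := Fintype.equivOfCardEq (by simp [ha])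
  have hS : ∀ i, #{u | (φ u).1 = i} ≤ a := fun i => by
    refine (card_le_card_of_injOn (t := univ) (fun u => (φ u).2) (by simp) ?_).trans_eq
      (card_fin a)
    intro u hu v hv h
    simp only [coe_filter, mem_univ, true_and, Set.mem_ofPred_eq] at hu hv
    exact φ.injective (Prod.ext (hu.trans hv.symm) h)
  have hE : ∀ i, #{e ∈ E | (φ e.1).1 = i} ≤ a * d := fun i => by
    rw [mul_comm]
    refine (card_le_mul_card_image_of_maps_to (f := Prod.fst) (t := {u | (φ u).1 = i})
      (by simp) d fun u _ => ?_).trans (Nat.mul_le_mul_left d (hS i))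
    exact (card_le_card (filter_subset_filter _ (filter_subset _ _))).trans (hdegU u)
  obtain ⟨t, ht, hst⟩ := exists_balanced_coloring (κ := Fin (a + b + 1)) (fun u => (φ u).1) E hd
    (by simp [add_assoc]) (Nat.le_add_left 1 b) hWcard.le hdegW hE
  refine ⟨fun i => {u | (φ u).1 = i}, fun j => {w | t w = j}, ?_, by simp, ?_, by simp,
    fun i => (hS i).trans (by omega), fun j => (ht j).trans (by omega), by simpa using hst⟩
  · exact fun i j hij => disjoint_filter.2 fun u _ hi hj => hij (hi.symm.trans hj)
  · exact fun i j hij => disjoint_filter.2 fun w _ hi hj => hij (hi.symm.trans hj)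
end

section
/- Let ψ be a 3CNF formula with clause set C over variable set Vars, let S_1,…,S_m be a partition of Vars and T_1,…,T_m a partition of C, and let F_ψ be the associated clause–variable free game. Suppose that every assignment α : Vars → {0,1} leaves at least k clauses of C unsatisfied, and that there is a constant B ≥ 1 such that for all i, j the number of pairs (v,c) with v ∈ S_i, c ∈ T_j and v occurring in c is at most B. Then ω(F_ψ) ≤ 1 − k/(B·m²). -/
open Finset

/-- A clause falsified by the assignment glued from the row answers contains a variable whose
block loses against the block of that clause. -/
theorem exists_mem_clauseVarV_eq_zero {Vars : Type*} {m : ℕ} {S : Fin m → Finset Vars}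
    {T : Fin m → Finset (Finset (Vars × Bool))} {s₁ s₂ : Fin m → Vars → Bool}
    {ι : Vars → Fin m} (hι : ∀ v, v ∈ S (ι v)) {c : Finset (Vars × Bool)} (hc : c.Nonempty)
    {j : Fin m} (hcj : c ∈ T j) (hα : ¬ SatClause (fun v => s₁ (ι v) v) c) :
    ∃ l ∈ c, clauseVarV S T (ι l.1) j (s₁ (ι l.1)) (s₂ j) = 0 := by
  by_cases hβ : ∀ d ∈ T j, SatClause (s₂ j) d
  · obtain ⟨l, hl, hsat⟩ := hβ c hcj
    refine ⟨l, hl, if_neg ?_⟩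
    rintro ⟨-, hagree⟩
    exact hα ⟨l, hl, (hagree l.1 (hι l.1) ⟨c, hcj, l.2, hl⟩).trans hsat⟩
  · obtain ⟨l, hl⟩ := hc
    exact ⟨l, hl, if_neg fun h => hβ h.1⟩

open Classical in
/-- The verifier's total over all question pairs is `m²` minus the number of losing pairs. -/
theorem sum_clauseVarV {Vars : Type*} {m : ℕ} (S : Fin m → Finset Vars)
    (T : Fin m → Finset (Finset (Vars × Bool))) (s₁ s₂ : Fin m → Vars → Bool) :
    ∑ i, ∑ j, clauseVarV S T i j (s₁ i) (s₂ j) = (m : ℝ) ^ 2 -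
      ((univ : Finset (Fin m × Fin m)).filter
        fun p => clauseVarV S T p.1 p.2 (s₁ p.1) (s₂ p.2) = 0).card := by
  have hpt : ∀ p : Fin m × Fin m, clauseVarV S T p.1 p.2 (s₁ p.1) (s₂ p.2) =
      1 - if clauseVarV S T p.1 p.2 (s₁ p.1) (s₂ p.2) = 0 then (1 : ℝ) else 0 := by
    intro p
    unfold clauseVarV
    split_ifs <;> simp_all
  rw [← Fintype.sum_prod_type', Finset.sum_congr rfl fun p _ => hpt p,
    Finset.sum_sub_distrib, Finset.sum_boole]
  simp [sq]

open Classical in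
/-- if every assignment leaves at least `k` clauses of `C` unsatisfied and
every block pair `(S i, T j)` contains at most `B` variable-occurrence pairs, then the
clause–variable free game has value at most `1 - k/(B·m²)`. -/
theorem clauseVar_value_le_of_unsat {Vars : Type*} [Fintype Vars] [DecidableEq Vars]
    {m : ℕ} (hm : 0 < m)
    (C : Finset (Finset (Vars × Bool)))
    (hC : ∀ c ∈ C, c.card = 3 ∧ (c.image Prod.fst).card = 3)
    (S : Fin m → Finset Vars) (T : Fin m → Finset (Finset (Vars × Bool)))
    (hSdisj : ∀ i j, i ≠ j → Disjoint (S i) (S j))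
    (hScover : ∀ v : Vars, ∃ i, v ∈ S i)
    (hTdisj : ∀ i j, i ≠ j → Disjoint (T i) (T j))
    (hTunion : ∀ c, (∃ j, c ∈ T j) ↔ c ∈ C)
    (k : ℕ) (B : ℝ) (hB : 1 ≤ B)
    (hunsat : ∀ α : Vars → Bool, k ≤ (C.filter (fun c => ¬ SatClause α c)).card)
    (hocc : ∀ i j, ((((S i) ×ˢ (T j)).filter
        (fun p => ∃ b : Bool, (p.1, b) ∈ p.2)).card : ℝ) ≤ B) :
    gameValue (clauseVarV S T) ≤ 1 - (k : ℝ) / (B * (m : ℝ) ^ 2) := by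
  have hm' : (0 : ℝ) < m := Nat.cast_pos.mpr hm
  have hB' : 0 < B := zero_lt_one.trans_le hB
  choose ι hι using hScover
  refine ciSup_le ?_
  rintro ⟨s₁, s₂⟩
  set L := (univ : Finset (Fin m × Fin m)).filter
    fun p => clauseVarV S T p.1 p.2 (s₁ p.1) (s₂ p.2) = 0 with hL
  set U := C.filter fun c => ¬ SatClause (fun v => s₁ (ι v) v) c with hU
  have hex : ∀ c : Finset (Vars × Bool), c ∈ U → ∃ (j : Fin m) (l : Vars × Bool),
      c ∈ T j ∧ l ∈ c ∧ clauseVarV S T (ι l.1) j (s₁ (ι l.1)) (s₂ j) = 0 := by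
    intro c hc
    obtain ⟨hcC, hα⟩ := Finset.mem_filter.mp hc
    obtain ⟨j, hj⟩ := (hTunion c).mpr hcC
    have hne : c.Nonempty := Finset.card_pos.mp (by rw [(hC c hcC).1]; norm_num)
    obtain ⟨l, hl, h0⟩ := exists_mem_clauseVarV_eq_zero (s₂ := s₂) hι hne hj hα
    exact ⟨j, l, hj, hl, h0⟩
  have : Nonempty (Fin m) := ⟨⟨0, hm⟩⟩
  have hcount : (U.card : ℝ) ≤ L.card * B := by
    by_cases hUe : U = ∅
    · rw [hUe, Finset.card_empty, Nat.cast_zero]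
      positivity
    obtain ⟨c₀, hc₀⟩ := Finset.nonempty_iff_ne_empty.mpr hUe
    have : Nonempty (Vars × Bool) := ⟨(hex c₀ hc₀).choose_spec.choose⟩
    choose! j l hjT hlc h0 using hex
    have hmaps : ∀ c ∈ U, (ι (l c).1, j c) ∈ L := fun c hc => by
      simpa [hL] using h0 c hc
    rw [Finset.card_eq_sum_card_fiberwise hmaps, Nat.cast_sum, ← nsmul_eq_mul]
    refine Finset.sum_le_card_nsmul _ _ _ fun p _ => le_trans ?_ (hocc p.1 p.2)
    refine Nat.cast_le.mpr (Finset.card_le_card_of_injOn (fun c => ((l c).1, c)) ?_ ?_)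
    · intro c hc
      obtain ⟨hcU, rfl⟩ := Finset.mem_filter.mp hc
      refine Finset.mem_coe.mpr (Finset.mem_filter.mpr
        ⟨Finset.mem_product.mpr ⟨hι _, hjT c hcU⟩, (l c).2, hlc c hcU⟩)
    · intro c _ d _ h
      exact congrArg Prod.snd h
  have hk : (k : ℝ) ≤ L.card * B := (Nat.cast_le.mpr (hunsat _)).trans hcount
  have hpay : freePayoff (clauseVarV S T) s₁ s₂ = 1 - L.card / (m : ℝ) ^ 2 := by
    rw [freePayoff, sum_clauseVarV, Fintype.card_fin]
    field_simp
    congr!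
  rw [hpay]
  refine sub_le_sub_left ?_ 1
  rw [div_le_div_iff₀ (by positivity) (by positivity)]
  nlinarith [mul_le_mul_of_nonneg_right hk (sq_nonneg (m : ℝ))]
end

section
/- Let F = (X,Y,A,B,V) be a free game with |X| and |Y| even and ω(F) = 1, and let g ∈ (0,1/4] and δ ∈ (0,1]. Then the game G(F,g,δ) has a (1−4gδ)-UNE (x,y) in which each player's payoff equals 1, so sw(x,y) = 2. Moreover (x,y) can be chosen to be a well-supported (1−4gδ)-UNE in which x is the uniform distribution over the set {(q, s₁(q)) : q ∈ X} of size |X| and y is the uniform distribution over the set {(r, s₂(r)) : r ∈ Y} of size |Y|, where (s₁,s₂) is an optimal strategy pair for F. -/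
open Finset

section Bimatrix

variable {I J : Type*} [Fintype I] [Fintype J]

lemma pay_eq_sum_rowPay (M : I → J → ℝ) (x : I → ℝ) (y : J → ℝ) :
    pay M x y = ∑ i, x i * rowPay M y i := by
  simp only [pay, rowPay, Finset.mul_sum, mul_assoc]

lemma pay_eq_sum_colPay (M : I → J → ℝ) (x : I → ℝ) (y : J → ℝ) :
    pay M x y = ∑ j, y j * colPay M x j := by
  simp only [pay, colPay, Finset.mul_sum]
  rw [Finset.sum_comm]
  exact Finset.sum_congr rfl fun j _ => Finset.sum_congr rfl fun i _ => by ring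

lemma IsDist.sum_mul_eq {x : I → ℝ} (hx : IsDist x) {φ : I → ℝ} {v : ℝ}
    (h : ∀ i, 0 < x i → φ i = v) : ∑ i, x i * φ i = v := by
  have key : ∀ i, x i * φ i = x i * v := fun i => by
    rcases (hx.1 i).eq_or_lt with h0 | h0
    · simp [← h0]
    · rw [h i h0]
  rw [Finset.sum_congr rfl fun i _ => key i, ← Finset.sum_mul, hx.2, one_mul]

end Bimatrix

section UniformGraph

variable {X A K : Type*} [Fintype X] [Fintype A] [Fintype K] [DecidableEq A]

/-- The uniform distribution over the graph of `s`, extended by zero to `K`. -/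
noncomputable def uniformGraph (K : Type*) (s : X → A) : X × A ⊕ K → ℝ :=
  Sum.elim (fun p : X × A => if p.2 = s p.1 then ((Fintype.card X : ℝ))⁻¹ else 0) (fun _ => 0)

lemma sum_uniformGraph_mul (s : X → A) (φ : X × A ⊕ K → ℝ) :
    ∑ i, uniformGraph K s i * φ i = (Fintype.card X : ℝ)⁻¹ * ∑ q, φ (Sum.inl (q, s q)) := by
  simp [uniformGraph, Fintype.sum_sum_type, Fintype.sum_prod_type, Finset.mul_sum]

lemma isDist_uniformGraph [Nonempty X] (s : X → A) : IsDist (uniformGraph K s) := by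
  refine ⟨?_, ?_⟩
  · rintro (p | k)
    · simp only [uniformGraph, Sum.elim_inl]
      positivity
    · simp [uniformGraph]
  · simpa using sum_uniformGraph_mul (K := K) s fun _ => 1

lemma rowPay_uniformGraph {I : Type*} (M : I → X × A ⊕ K → ℝ) (s : X → A) (i : I) :
    rowPay M (uniformGraph K s) i = (Fintype.card X : ℝ)⁻¹ * ∑ q, M i (Sum.inl (q, s q)) := by
  simp only [rowPay, mul_comm (M i _)]
  exact sum_uniformGraph_mul s (M i)

end UniformGraph

lemma eq_inl_of_uniformGraph_pos {X A K : Type*} [Fintype X] [DecidableEq A] {s : X → A}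
    {i : X × A ⊕ K} (h : 0 < uniformGraph K s i) : ∃ q, i = Sum.inl (q, s q) := by
  rcases i with ⟨q, a⟩ | k
  · by_cases ha : a = s q
    · exact ⟨q, by rw [ha]⟩
    · simp [uniformGraph, ha] at h
  · simp [uniformGraph] at h

lemma HalfFns.average_ite {Y : Type*} [Fintype Y] [Nonempty Y] (f : HalfFns Y) (c : ℝ) :
    (Fintype.card Y : ℝ)⁻¹ * ∑ r, (if f.1 r = true then c else 0) = c / 2 := by
  have hf : (2 : ℝ) * (Finset.univ.filter fun r => f.1 r = true).card = Fintype.card Y :=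
    mod_cast f.2
  have hY : (Fintype.card Y : ℝ) ≠ 0 := by positivity
  rw [← Finset.sum_filter, Finset.sum_const, nsmul_eq_mul, inv_mul_eq_div,
    div_eq_div_iff hY two_ne_zero, ← hf]
  ring

lemma exists_freePayoff_eq_gameValue {X Y A B : Type*} [Fintype X] [Fintype Y] [Fintype A]
    [Fintype B] [Nonempty A] [Nonempty B] (V : X → Y → A → B → ℝ) :
    ∃ s : (X → A) × (Y → B), freePayoff V s.1 s.2 = gameValue V := by
  classical
  exact exists_eq_ciSup_of_finite

lemma eq_one_of_freePayoff_eq_one {X Y A B : Type*} [Fintype X] [Fintype Y] [Nonempty X]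
    [Nonempty Y] {V : X → Y → A → B → ℝ}
    (hV : ∀ x y a b, V x y a b ≤ 1) {s₁ : X → A} {s₂ : Y → B} (h : freePayoff V s₁ s₂ = 1)
    (q : X) (r : Y) : V q r (s₁ q) (s₂ r) = 1 := by
  have hX : (Fintype.card X : ℝ) ≠ 0 := by positivity
  have hY : (Fintype.card Y : ℝ) ≠ 0 := by positivity
  have hsum : ∑ q, ∑ r, V q r (s₁ q) (s₂ r) = ∑ _q : X, ∑ _r : Y, (1 : ℝ) := by
    rw [freePayoff, one_div, inv_mul_eq_one₀ (mul_ne_zero hX hY)] at h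
    simp [← h]
  have hle : ∀ q ∈ Finset.univ, ∑ r, V q r (s₁ q) (s₂ r) ≤ ∑ _r : Y, (1 : ℝ) :=
    fun q _ => Finset.sum_le_sum fun r _ => hV _ _ _ _
  have hq := (Finset.sum_eq_sum_iff_of_le hle).1 hsum q (Finset.mem_univ q)
  exact (Finset.sum_eq_sum_iff_of_le fun r _ => hV _ _ _ _).1 hq r (Finset.mem_univ r)

lemma GCol_eq_GRow_swap {X Y A B : Type*} [Fintype X] [Fintype Y] (V : X → Y → A → B → ℝ)
    (g δ : ℝ) (i : X × A ⊕ HalfFns Y) (j : Y × B ⊕ HalfFns X) :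
    GCol V g δ i j = GRow (fun r q b a => V q r a b) g δ j i := by
  rcases i with ⟨q, a⟩ | f <;> rcases j with ⟨r, b⟩ | f' <;> rfl

lemma colPay_GCol {X Y A B : Type*} [Fintype X] [Fintype Y] [Fintype A] [DecidableEq Y]
    (V : X → Y → A → B → ℝ) (g δ : ℝ) (x : X × A ⊕ HalfFns Y → ℝ)
    (j : Y × B ⊕ HalfFns X) :
    colPay (GCol V g δ) x j = rowPay (GRow (fun r q b a => V q r a b) g δ) x j := by
  simp only [colPay, rowPay, GCol_eq_GRow_swap, mul_comm]

section GGame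

variable {X Y A B : Type*} [Fintype X] [Fintype Y] [Fintype B] [DecidableEq X] [DecidableEq B]

lemma rowPay_GRow_eq_one [DecidableEq A] [Nonempty Y] {V : X → Y → A → B → ℝ} {s₁ : X → A}
    {s₂ : Y → B} (h : ∀ q r, V q r (s₁ q) (s₂ r) = 1) (g δ : ℝ) (i : X × A ⊕ HalfFns Y)
    (hi : 0 < uniformGraph _ s₁ i) :
    rowPay (GRow V g δ) (uniformGraph _ s₂) i = 1 := by
  obtain ⟨q, rfl⟩ := eq_inl_of_uniformGraph_pos hi
  simp [rowPay_uniformGraph, GRow, h]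

lemma rowPay_GRow_le [Nonempty Y] {V : X → Y → A → B → ℝ} (hV : ∀ x y a b, V x y a b ≤ 1)
    (s₂ : Y → B) {g δ : ℝ} (h0 : 0 ≤ 4 * g * δ) (h1 : 4 * g * δ ≤ 1) (i : X × A ⊕ HalfFns Y) :
    rowPay (GRow V g δ) (uniformGraph _ s₂) i ≤ 1 + (1 - 4 * g * δ) := by
  rw [rowPay_uniformGraph]
  rcases i with ⟨q, a⟩ | f
  · have hY : (0 : ℝ) < Fintype.card Y := by positivity
    have hsum : ∑ r, V q r a (s₂ r) ≤ Fintype.card Y := by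
      simpa using Finset.sum_le_sum fun r (_ : r ∈ Finset.univ) => hV q r a (s₂ r)
    have hle : (Fintype.card Y : ℝ)⁻¹ * ∑ r, V q r a (s₂ r) ≤ 1 := by
      rwa [inv_mul_le_iff₀ hY, mul_one]
    exact hle.trans (by linarith)
  · simp only [GRow]
    rw [HalfFns.average_ite, div_div, div_le_iff₀ (by linarith)]
    nlinarith [mul_nonneg h0 (sub_nonneg.2 h1)]

end GGame

/-- completeness, Lemma 5: if `ω(F) = 1`, `g ∈ (0,1/4]`, `δ ∈ (0,1]`,
then `G(F,g,δ)` has a (well-supported) `(1-4gδ)`-UNE in which both players get payoff `1`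
(so social welfare `2`), obtained by mixing uniformly over an optimal strategy pair of `F`. -/
theorem completeness_UNE {X Y A B : Type*} [Fintype X] [Fintype Y] [Fintype A] [Fintype B]
    [DecidableEq X] [DecidableEq Y] [DecidableEq A] [DecidableEq B]
    [Nonempty X] [Nonempty Y] [Nonempty A] [Nonempty B]
    (V : X → Y → A → B → ℝ) (hV : ∀ x y a b, V x y a b = 0 ∨ V x y a b = 1)
    (hX : Even (Fintype.card X)) (hY : Even (Fintype.card Y))
    (g δ : ℝ) (hg0 : 0 < g) (hg : g ≤ 1 / 4) (hδ0 : 0 < δ) (hδ : δ ≤ 1)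
    (hω : gameValue V = 1) :
    ∃ (s₁ : X → A) (s₂ : Y → B), freePayoff V s₁ s₂ = 1 ∧
      ∃ (x : X × A ⊕ HalfFns Y → ℝ) (y : Y × B ⊕ HalfFns X → ℝ),
        x = Sum.elim
            (fun p : X × A => if p.2 = s₁ p.1 then ((Fintype.card X : ℝ))⁻¹ else 0)
            (fun _ => 0) ∧
        y = Sum.elim
            (fun p : Y × B => if p.2 = s₂ p.1 then ((Fintype.card Y : ℝ))⁻¹ else 0)
            (fun _ => 0) ∧
        IsEpsNE (GRow V g δ) (GCol V g δ) x y (1 - 4 * g * δ) ∧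
        IsEpsWSNE (GRow V g δ) (GCol V g δ) x y (1 - 4 * g * δ) ∧
        pay (GRow V g δ) x y = 1 ∧ pay (GCol V g δ) x y = 1 ∧
        sw (GRow V g δ) (GCol V g δ) x y = 2 := by
  have hV1 : ∀ x y a b, V x y a b ≤ 1 := fun x y a b => by
    rcases hV x y a b with h | h <;> simp [h]
  have h0 : 0 ≤ 4 * g * δ := by positivity
  have h1 : 4 * g * δ ≤ 1 := by nlinarith
  obtain ⟨⟨s₁, s₂⟩, hs⟩ := exists_freePayoff_eq_gameValue V
  rw [hω] at hs
  have hwin := eq_one_of_freePayoff_eq_one hV1 hs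
  refine ⟨s₁, s₂, hs, uniformGraph _ s₁, uniformGraph _ s₂, rfl, rfl, ?_⟩
  have hx : IsDist (uniformGraph (HalfFns Y) s₁) := isDist_uniformGraph s₁
  have hy : IsDist (uniformGraph (HalfFns X) s₂) := isDist_uniformGraph s₂
  have hrow := rowPay_GRow_eq_one hwin g δ
  have hrow_le := rowPay_GRow_le hV1 s₂ h0 h1
  have hcol : ∀ j, 0 < uniformGraph (HalfFns X) s₂ j →
      colPay (GCol V g δ) (uniformGraph _ s₁) j = 1 := fun j hj => by
    rw [colPay_GCol]
    exact rowPay_GRow_eq_one (fun r q => hwin q r) g δ j hj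
  have hcol_le : ∀ j, colPay (GCol V g δ) (uniformGraph _ s₁) j ≤ 1 + (1 - 4 * g * δ) :=
    fun j => by
      rw [colPay_GCol]
      exact rowPay_GRow_le (fun r q b a => hV1 q r a b) s₁ h0 h1 j
  have hpayR : pay (GRow V g δ) (uniformGraph _ s₁) (uniformGraph _ s₂) = 1 := by
    rw [pay_eq_sum_rowPay]
    exact hx.sum_mul_eq hrow
  have hpayC : pay (GCol V g δ) (uniformGraph _ s₁) (uniformGraph _ s₂) = 1 := by
    rw [pay_eq_sum_colPay]
    exact hy.sum_mul_eq hcol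
  refine ⟨⟨hx, hy, fun i => ?_, fun j => ?_⟩, ⟨hx, hy, fun i hi k => ?_, fun j hj k => ?_⟩,
    hpayR, hpayC, ?_⟩
  · linarith [hrow_le i]
  · linarith [hcol_le j]
  · linarith [hrow i hi, hrow_le k]
  · linarith [hcol j hj, hcol_le k]
  · rw [sw, hpayR, hpayC]
    norm_num
end

section
/- Let F = (X,Y,A,B,V) be a free game with |X| and |Y| even and let g, δ > 0 with gδ ≤ 1. For every mixed strategy pair (x,y) of G(F,g,δ) with sw(x,y) > 2 − 2gδ, the strategy x assigns total probability at least 1−gδ to rows in X×A, and y assigns total probability at least 1−gδ to columns in Y×B. -/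
open Finset

/-- If `R + C` is at most `2` on `Sum.inl × Sum.inl` and at most `0` elsewhere, then the social
welfare is at most twice the product of the masses put on the `Sum.inl` parts. -/
theorem sw_le_two_mul_inl_mass {I I' J J' : Type*} [Fintype I] [Fintype I'] [Fintype J]
    [Fintype J'] (R C : I ⊕ I' → J ⊕ J' → ℝ) (x : I ⊕ I' → ℝ) (y : J ⊕ J' → ℝ)
    (hx : ∀ i, 0 ≤ x i) (hy : ∀ j, 0 ≤ y j)
    (h : ∀ i j, R i j + C i j ≤
      2 * Sum.elim (fun _ => 1) (fun _ => 0) i * Sum.elim (fun _ => 1) (fun _ => 0) j) :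
    sw R C x y ≤ 2 * ((∑ i, x (Sum.inl i)) * ∑ j, y (Sum.inl j)) := by
  have key : sw R C x y ≤ ∑ i, ∑ j, 2 * ((x i * Sum.elim (fun _ => 1) (fun _ => 0) i) *
      (y j * Sum.elim (fun _ => 1) (fun _ => 0) j)) := by
    unfold sw pay
    simp only [← Finset.sum_add_distrib]
    refine Finset.sum_le_sum fun i _ => Finset.sum_le_sum fun j _ => ?_
    have := mul_le_mul_of_nonneg_left (h i j) (mul_nonneg (hx i) (hy j))
    linarith
  refine key.trans_eq ?_
  simp only [← Finset.mul_sum, ← Finset.sum_mul]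
  simp [Fintype.sum_sum_type]

theorem IsDist.sum_inl_nonneg {I I' : Type*} [Fintype I] [Fintype I'] {x : I ⊕ I' → ℝ}
    (hx : IsDist x) : 0 ≤ ∑ i, x (Sum.inl i) :=
  Finset.sum_nonneg fun _ _ => hx.1 _

theorem IsDist.sum_inl_le_one {I I' : Type*} [Fintype I] [Fintype I'] {x : I ⊕ I' → ℝ}
    (hx : IsDist x) : ∑ i, x (Sum.inl i) ≤ 1 := by
  have h := hx.2
  rw [Fintype.sum_sum_type] at h
  have : 0 ≤ ∑ i, x (Sum.inr i) := Finset.sum_nonneg fun i _ => hx.1 _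
  linarith

/-- Lemma 6: any strategy profile of `G(F,g,δ)` with social welfare
greater than `2 - 2gδ` puts probability at least `1 - gδ` on the subgame `(R,C)`. -/
theorem high_welfare_prob_on_RC {X Y A B : Type*}
    [Fintype X] [Fintype Y] [Fintype A] [Fintype B]
    [DecidableEq X] [DecidableEq Y]
    [Nonempty X] [Nonempty Y] [Nonempty A] [Nonempty B]
    (V : X → Y → A → B → ℝ) (hV : ∀ x y a b, V x y a b = 0 ∨ V x y a b = 1)
    (hX : Even (Fintype.card X)) (hY : Even (Fintype.card Y))
    (g δ : ℝ) (hg0 : 0 < g) (hδ0 : 0 < δ) (hgδ : g * δ ≤ 1)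
    (x : X × A ⊕ HalfFns Y → ℝ) (y : Y × B ⊕ HalfFns X → ℝ)
    (hx : IsDist x) (hy : IsDist y)
    (hsw : 2 - 2 * g * δ < sw (GRow V g δ) (GCol V g δ) x y) :
    1 - g * δ ≤ ∑ p : X × A, x (Sum.inl p) ∧
    1 - g * δ ≤ ∑ p : Y × B, y (Sum.inl p) := by
  have hle := sw_le_two_mul_inl_mass (GRow V g δ) (GCol V g δ) x y hx.1 hy.1 (by
    rintro (⟨q, a⟩ | f) (⟨r, b⟩ | f')
    · rcases hV q r a b with h | h <;> norm_num [GRow, GCol, h]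
    all_goals simp [GRow, GCol])
  have hP := mul_le_of_le_one_right hx.sum_inl_nonneg hy.sum_inl_le_one
  have hQ := mul_le_of_le_one_left hy.sum_inl_nonneg hx.sum_inl_le_one
  constructor <;> linarith
end

section
/- Let Y be a finite set of even cardinality, let g, δ > 0 and c > 0, and let y' : Y → [0,∞) satisfy 1 − gδ ≤ ∑_{i∈Y} y'_i ≤ 1. Let u_Y be the uniform distribution on Y. If ‖u_Y − y'‖₁ ≥ c, then there exists a subset B ⊆ Y with |B| = |Y|/2 such that ∑_{i∈B} y'_i > 1/2 + c/4 − 2gδ. -/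
open Finset

/-- Among the `k`-element subsets of a finite type there is one all of whose elements have
`f`-value at least that of every element outside it. -/
theorem exists_card_eq_forall_notMem_le {Y : Type*} [Fintype Y] (f : Y → ℝ) {k : ℕ}
    (hk : k ≤ Fintype.card Y) :
    ∃ B : Finset Y, B.card = k ∧ ∀ b ∈ B, ∀ a ∉ B, f a ≤ f b := by
  classical
  obtain ⟨B, hB, hmax⟩ := Finset.exists_max_image (Finset.powersetCard k (Finset.univ : Finset Y))
    (fun B => ∑ i ∈ B, f i) (Finset.powersetCard_nonempty.2 hk)
  have hcard : B.card = k := (Finset.mem_powersetCard.1 hB).2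
  refine ⟨B, hcard, fun b hb a ha => ?_⟩
  have ha' : a ∉ B.erase b := fun h => ha (Finset.mem_of_mem_erase h)
  have hswap := hmax (insert a (B.erase b)) (Finset.mem_powersetCard.2
    ⟨Finset.subset_univ _, by
      rw [Finset.card_insert_of_notMem ha', Finset.card_erase_add_one hb, hcard]⟩)
  have hsum := Finset.add_sum_erase B f hb
  simp only [Finset.sum_insert ha'] at hswap
  linarith

/-- If `B` contains half of the elements and `d` is at least as large on `B` as on its
complement, then the sum of `d` over `B` is controlled from below by the `ℓ₁` norm of `d`
and its total sum. -/
theorem l1_add_min_le_four_mul_sum_of_half {Y : Type*} [Fintype Y] [DecidableEq Y] (d : Y → ℝ)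
    {B : Finset Y} (hne : B.Nonempty) (hcard : Bᶜ.card = B.card)
    (hB : ∀ b ∈ B, ∀ a ∉ B, d a ≤ d b) :
    l1 d + min (∑ i, d i) (3 * ∑ i, d i) ≤ 4 * ∑ i ∈ B, d i := by
  obtain ⟨b, hb, hmin⟩ := Finset.exists_min_image B d hne
  have habs : l1 d = ∑ i ∈ B, |d i| + ∑ i ∈ Bᶜ, |d i| := (Finset.sum_add_sum_compl B _).symm
  have htot := Finset.sum_add_sum_compl B d
  have hlow : B.card * d b ≤ ∑ i ∈ B, d i := by
    simpa using Finset.card_nsmul_le_sum B d (d b) hmin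
  have hhigh : ∑ i ∈ Bᶜ, d i ≤ B.card * d b := by
    simpa [hcard] using Finset.sum_le_card_nsmul Bᶜ d (d b)
      (fun a ha => hB b hb a (Finset.mem_compl.1 ha))
  rcases le_total 0 (d b) with h0 | h0
  · have hBabs : ∑ i ∈ B, |d i| = ∑ i ∈ B, d i :=
      Finset.sum_congr rfl fun i hi => abs_of_nonneg (h0.trans (hmin i hi))
    have hCabs : ∑ i ∈ Bᶜ, (|d i| + d i) ≤ B.card * (2 * d b) := by
      have := Finset.sum_le_card_nsmul Bᶜ (fun i => |d i| + d i) (2 * d b) fun a ha => by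
        have := hB b hb a (Finset.mem_compl.1 ha)
        rcases abs_cases (d a) with h | h <;> linarith
      simpa [hcard] using this
    rw [Finset.sum_add_distrib] at hCabs
    linarith [min_le_left (∑ i, d i) (3 * ∑ i, d i)]
  · have hCabs : ∑ i ∈ Bᶜ, |d i| = -∑ i ∈ Bᶜ, d i := by
      rw [← Finset.sum_neg_distrib]
      exact Finset.sum_congr rfl fun i hi =>
        abs_of_nonpos ((hB b hb i (Finset.mem_compl.1 hi)).trans h0)
    have hBabs : ∑ i ∈ B, (|d i| - d i) ≤ B.card * (-2 * d b) := by
      have := Finset.sum_le_card_nsmul B (fun i => |d i| - d i) (-2 * d b) fun a ha => by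
        have := hmin a ha
        rcases abs_cases (d a) with h | h <;> linarith
      simpa using this
    rw [Finset.sum_sub_distrib] at hBabs
    linarith [min_le_right (∑ i, d i) (3 * ∑ i, d i)]

/-- Lemma 8: if a nonnegative vector `y'` with total mass in
`[1 - gδ, 1]` is at ℓ₁ distance at least `c` from the uniform distribution on `Y`,
then some half-sized subset of `Y` carries mass more than `1/2 + c/4 - 2gδ`. -/
theorem half_subset_of_far_from_uniform {Y : Type*} [Fintype Y]
    (hY : Even (Fintype.card Y))
    (g δ c : ℝ) (hg : 0 < g) (hδ : 0 < δ) (hc : 0 < c)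
    (y' : Y → ℝ) (hpos : ∀ i, 0 ≤ y' i)
    (hlow : 1 - g * δ ≤ ∑ i, y' i) (hup : ∑ i, y' i ≤ 1)
    (hl1 : c ≤ l1 (fun i => (Fintype.card Y : ℝ)⁻¹ - y' i)) :
    ∃ B : Finset Y, 2 * B.card = Fintype.card Y ∧
      1 / 2 + c / 4 - 2 * g * δ < ∑ i ∈ B, y' i := by
  classical
  have hY0 : 0 < Fintype.card Y := by
    rw [Fintype.card_pos_iff]
    by_contra hempty
    rw [not_nonempty_iff] at hempty
    simp only [l1, Finset.univ_eq_empty, Finset.sum_empty] at hl1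
    linarith
  obtain ⟨k, hk⟩ := hY
  obtain ⟨B, hBk, hB⟩ := exists_card_eq_forall_notMem_le y' (k := k) (by omega)
  refine ⟨B, by omega, ?_⟩
  have hkey := l1_add_min_le_four_mul_sum_of_half (fun i => y' i - (Fintype.card Y : ℝ)⁻¹)
    (B := B) (Finset.card_pos.1 (by omega)) (by rw [Finset.card_compl]; omega)
    (fun b hb a ha => sub_le_sub_right (hB b hb a ha) _)
  have hl1_comm : l1 (fun i => y' i - (Fintype.card Y : ℝ)⁻¹) =
      l1 (fun i => (Fintype.card Y : ℝ)⁻¹ - y' i) :=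
    Finset.sum_congr rfl fun i _ => abs_sub_comm _ _
  have hn : (Fintype.card Y : ℝ) ≠ 0 := by exact_mod_cast hY0.ne'
  have htotal : ∑ i, (y' i - (Fintype.card Y : ℝ)⁻¹) = ∑ i, y' i - 1 := by
    simp [Finset.sum_sub_distrib, hn]
  have hhalf : ∑ i ∈ B, (y' i - (Fintype.card Y : ℝ)⁻¹) = ∑ i ∈ B, y' i - 1 / 2 := by
    have hcast : (Fintype.card Y : ℝ) = 2 * B.card := by
      rw [hk, hBk]; push_cast; ring
    have hB0 : (B.card : ℝ) ≠ 0 := fun h => hn (by rw [hcast, h, mul_zero])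
    rw [Finset.sum_sub_distrib, Finset.sum_const, nsmul_eq_mul, hcast]
    field_simp
  rw [hl1_comm, htotal, hhalf, min_eq_right (by linarith)] at hkey
  nlinarith [mul_pos hg hδ]
end

section
/- Let F = (X,Y,A,B,V) be a free game with |X| and |Y| even and let g ∈ (0,1/4], δ ∈ (0,1]. Let (x,y) be a (1−4gδ)-UNE of G(F,g,δ) whose question marginals satisfy ‖x'‖₁ ≥ 1 − gδ and ‖y'‖₁ ≥ 1 − gδ. Then ‖u_X − x'‖₁ < 16gδ and ‖u_Y − y'‖₁ < 16gδ, where u_X and u_Y are the uniform distributions on X and Y. -/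
open Finset

section HalfSums

variable {ι : Type*} [Fintype ι]

/-- A `k`-subset of maximal `z`-sum is separated from its complement by a threshold. -/
lemma exists_card_eq_threshold [DecidableEq ι] (z : ι → ℝ) {k : ℕ} (hk : 0 < k)
    (hkι : k ≤ Fintype.card ι) :
    ∃ (T : Finset ι) (θ : ℝ), T.card = k ∧ (∀ i ∈ T, θ ≤ z i) ∧ ∀ j ∉ T, z j ≤ θ := by
  obtain ⟨T, hT, hmax⟩ := Finset.exists_max_image (Finset.powersetCard k (univ : Finset ι))
    (fun S => ∑ i ∈ S, z i) (Finset.powersetCard_nonempty.2 (by simpa using hkι))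
  have hcard : T.card = k := (Finset.mem_powersetCard.1 hT).2
  obtain ⟨m, hm, hmin⟩ := Finset.exists_min_image T z (Finset.card_pos.1 (hcard ▸ hk))
  refine ⟨T, z m, hcard, hmin, fun j hj => ?_⟩
  have hj' : j ∉ T.erase m := fun h => hj (Finset.mem_of_mem_erase h)
  have hle := hmax (insert j (T.erase m)) (Finset.mem_powersetCard.2 ⟨Finset.subset_univ _, by
    rw [Finset.card_insert_of_notMem hj', Finset.card_erase_of_mem hm]; omega⟩)
  simp only [Finset.sum_insert hj'] at hle
  linarith [Finset.add_sum_erase T z hm]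

/-- If `∑ z ≤ 0`, some half of the index set carries at least `(‖z‖₁ + 3 ∑ z) / 4`. -/
lemma exists_halfFns_l1_le [Nonempty ι] (hι : Even (Fintype.card ι)) (z : ι → ℝ)
    (hz : ∑ i, z i ≤ 0) :
    ∃ f : HalfFns ι, l1 z + 3 * ∑ i, z i ≤ 4 * ∑ i with f.1 i = true, z i := by
  classical
  obtain ⟨k, hk⟩ := hι
  have hpos : 0 < Fintype.card ι := Fintype.card_pos
  obtain ⟨T, θ, hT, hin, hout⟩ :=
    exists_card_eq_threshold z (show 0 < k by omega) (show k ≤ Fintype.card ι by omega)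
  have hTc : Tᶜ.card = k := by rw [Finset.card_compl]; omega
  refine ⟨⟨fun i => decide (i ∈ T), by simp [hT]; omega⟩, ?_⟩
  have hsplit := Finset.sum_add_sum_compl T z
  have habs : l1 z = ∑ i ∈ T, |z i| + ∑ i ∈ Tᶜ, |z i| :=
    (Finset.sum_add_sum_compl T fun i => |z i|).symm
  have hTθ : (k : ℝ) * θ ≤ ∑ i ∈ T, z i := by
    simpa [hT] using Finset.card_nsmul_le_sum T z θ hin
  have hTcθ : ∑ i ∈ Tᶜ, z i ≤ (k : ℝ) * θ := by
    simpa [hTc] using Finset.sum_le_card_nsmul Tᶜ z θ fun i hi => hout i (by simpa using hi)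
  simp only [decide_eq_true_eq, Finset.filter_mem_eq_inter, Finset.univ_inter]
  rcases le_total 0 θ with hθ | hθ
  · have h₁ : ∑ i ∈ T, |z i| = ∑ i ∈ T, z i :=
      Finset.sum_congr rfl fun i hi => abs_of_nonneg (hθ.trans (hin i hi))
    have h₂ : ∑ i ∈ Tᶜ, |z i| ≤ ∑ i ∈ Tᶜ, (2 * θ - z i) := by
      refine Finset.sum_le_sum fun i hi => abs_le.2 ⟨by linarith, ?_⟩
      linarith [hout i (by simpa using hi)]
    rw [Finset.sum_sub_distrib, Finset.sum_const, hTc, nsmul_eq_mul] at h₂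
    linarith
  · have h₁ : ∑ i ∈ Tᶜ, |z i| = -∑ i ∈ Tᶜ, z i := by
      rw [← Finset.sum_neg_distrib]
      exact Finset.sum_congr rfl fun i hi =>
        abs_of_nonpos ((hout i (by simpa using hi)).trans hθ)
    have h₂ : ∑ i ∈ T, |z i| ≤ ∑ i ∈ T, (z i - 2 * θ) := by
      refine Finset.sum_le_sum fun i hi => abs_le.2 ⟨?_, by linarith⟩
      linarith [hin i hi]
    rw [Finset.sum_sub_distrib, Finset.sum_const, hT, nsmul_eq_mul] at h₂
    linarith

/-- A subprobability vector gives some half of the index set weight above `1 / 2` by a quarter of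
its distance from uniform, up to its missing mass. -/
lemma exists_halfFns_weight [Nonempty ι] (hι : Even (Fintype.card ι)) (w : ι → ℝ)
    (hw : ∑ i, w i ≤ 1) :
    ∃ f : HalfFns ι, l1 (fun i => (Fintype.card ι : ℝ)⁻¹ - w i) + 3 * ∑ i, w i - 1 ≤
      4 * ∑ i with f.1 i = true, w i := by
  have hn : (Fintype.card ι : ℝ) ≠ 0 := Nat.cast_ne_zero.2 Fintype.card_ne_zero
  have hsum : ∑ i, (w i - (Fintype.card ι : ℝ)⁻¹) = ∑ i, w i - 1 := by
    simp [Finset.sum_sub_distrib, hn]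
  obtain ⟨f, hf⟩ := exists_halfFns_l1_le hι (fun i => w i - (Fintype.card ι : ℝ)⁻¹) (by linarith)
  refine ⟨f, ?_⟩
  have hl1 : l1 (fun i => (Fintype.card ι : ℝ)⁻¹ - w i) =
      l1 (fun i => w i - (Fintype.card ι : ℝ)⁻¹) :=
    Finset.sum_congr rfl fun i _ => abs_sub_comm _ _
  have hhalf : 2 * ((univ.filter fun i => f.1 i = true).card * (Fintype.card ι : ℝ)⁻¹) = 1 := by
    have : (2 : ℝ) * (univ.filter fun i => f.1 i = true).card = Fintype.card ι := by
      exact_mod_cast f.2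
    rw [← mul_assoc, this, mul_inv_cancel₀ hn]
  rw [hsum, Finset.sum_sub_distrib, Finset.sum_const, nsmul_eq_mul] at hf
  linarith

/-- The `ℓ₁` distance from uniform is at least the missing mass. -/
lemma one_sub_sum_le_l1 [Nonempty ι] (w : ι → ℝ) :
    1 - ∑ i, w i ≤ l1 (fun i => (Fintype.card ι : ℝ)⁻¹ - w i) := by
  have hn : (Fintype.card ι : ℝ) ≠ 0 := Nat.cast_ne_zero.2 Fintype.card_ne_zero
  calc 1 - ∑ i, w i = ∑ i, ((Fintype.card ι : ℝ)⁻¹ - w i) := by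
        simp [Finset.sum_sub_distrib, hn]
    _ ≤ _ := Finset.sum_le_sum fun i _ => le_abs_self _

end HalfSums

/-- If every joint payoff is at most `c`, so is the expected welfare. -/
lemma pay_add_pay_le {I J : Type*} [Fintype I] [Fintype J] {R C : I → J → ℝ} {x : I → ℝ}
    {y : J → ℝ} (hx : IsDist x) (hy : IsDist y) {c : ℝ} (h : ∀ i j, R i j + C i j ≤ c) :
    pay R x y + pay C x y ≤ c := by
  calc pay R x y + pay C x y = ∑ i, ∑ j, x i * y j * (R i j + C i j) := by
        simp only [pay, ← Finset.sum_add_distrib]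
        exact Finset.sum_congr rfl fun i _ => Finset.sum_congr rfl fun j _ => by ring
    _ ≤ ∑ i, ∑ j, x i * y j * c := Finset.sum_le_sum fun i _ => Finset.sum_le_sum fun j _ =>
        mul_le_mul_of_nonneg_left (h i j) (mul_nonneg (hx.1 i) (hy.1 j))
    _ = c := by
        simp only [← Finset.sum_mul, ← Finset.mul_sum, hy.2, hx.2]
        ring

lemma GRow_add_GCol_le {X Y A B : Type*} [Fintype X] [Fintype Y]
    (V : X → Y → A → B → ℝ) (hV : ∀ x y a b, V x y a b ≤ 1) (g δ : ℝ)
    (i : X × A ⊕ HalfFns Y) (j : Y × B ⊕ HalfFns X) : GRow V g δ i j + GCol V g δ i j ≤ 2 := by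
  rcases i with ⟨q, a⟩ | f <;> rcases j with ⟨r, b⟩ | f' <;> simp only [GRow, GCol]
  · linarith [hV q r a b]
  all_goals linarith

lemma rowPay_GRow_inr {X Y A B : Type*} [Fintype X] [Fintype Y] [Fintype B]
    [DecidableEq X] (V : X → Y → A → B → ℝ) (g δ : ℝ) (y : Y × B ⊕ HalfFns X → ℝ)
    (f : HalfFns Y) : rowPay (GRow V g δ) y (Sum.inr f) =
      4 / (1 + 4 * g * δ) * ∑ r with f.1 r = true, colMarg y r := by
  simp [rowPay, GRow, colMarg, Fintype.sum_sum_type, Fintype.sum_prod_type, Finset.mul_sum,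
    Finset.sum_filter, ite_mul]
  exact Finset.sum_congr rfl fun q _ => by split_ifs <;> simp

lemma colPay_GCol_inr {X Y A B : Type*} [Fintype X] [Fintype Y] [Fintype A]
    [DecidableEq Y] (V : X → Y → A → B → ℝ) (g δ : ℝ) (x : X × A ⊕ HalfFns Y → ℝ)
    (f : HalfFns X) : colPay (GCol V g δ) x (Sum.inr f) =
      4 / (1 + 4 * g * δ) * ∑ q with f.1 q = true, rowMarg x q := by
  simp [colPay, GCol, rowMarg, Fintype.sum_sum_type, Fintype.sum_prod_type, Finset.mul_sum,
    Finset.sum_filter, mul_comm]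
  exact Finset.sum_congr rfl fun q _ => by split_ifs <;> simp

/-- The marginal of a distribution on the left summand has `ℓ₁` norm equal to its mass,
which is at most one. -/
lemma IsDist.l1_marginal {Q S H : Type*} [Fintype Q] [Fintype S] [Fintype H]
    {x : Q × S ⊕ H → ℝ} (hx : IsDist x) :
    l1 (fun q => ∑ a, x (Sum.inl (q, a))) = ∑ q, ∑ a, x (Sum.inl (q, a)) ∧
      ∑ q, ∑ a, x (Sum.inl (q, a)) ≤ 1 := by
  refine ⟨Finset.sum_congr rfl fun q _ => abs_of_nonneg (Finset.sum_nonneg fun a _ => hx.1 _), ?_⟩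
  have h := hx.2
  rw [Fintype.sum_sum_type, Fintype.sum_prod_type] at h
  linarith [Finset.sum_nonneg fun f (_ : f ∈ (univ : Finset H)) => hx.1 (Sum.inr f)]

/-- Lemma 7: in a `(1-4gδ)`-UNE of `G(F,g,δ)` whose question marginals
have mass at least `1 - gδ`, both question marginals are within ℓ₁ distance `16gδ`
of the uniform distributions. -/
theorem marginals_close_to_uniform {X Y A B : Type*}
    [Fintype X] [Fintype Y] [Fintype A] [Fintype B]
    [DecidableEq X] [DecidableEq Y]
    [Nonempty X] [Nonempty Y] [Nonempty A] [Nonempty B]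
    (V : X → Y → A → B → ℝ) (hV : ∀ x y a b, V x y a b = 0 ∨ V x y a b = 1)
    (hX : Even (Fintype.card X)) (hY : Even (Fintype.card Y))
    (g δ : ℝ) (hg0 : 0 < g) (hg : g ≤ 1 / 4) (hδ0 : 0 < δ) (hδ : δ ≤ 1)
    (x : X × A ⊕ HalfFns Y → ℝ) (y : Y × B ⊕ HalfFns X → ℝ)
    (hne : IsEpsNE (GRow V g δ) (GCol V g δ) x y (1 - 4 * g * δ))
    (hxm : 1 - g * δ ≤ l1 (rowMarg x)) (hym : 1 - g * δ ≤ l1 (colMarg y)) :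
    l1 (fun q => (Fintype.card X : ℝ)⁻¹ - rowMarg x q) < 16 * g * δ ∧
    l1 (fun r => (Fintype.card Y : ℝ)⁻¹ - colMarg y r) < 16 * g * δ := by
  obtain ⟨hx, hy, hR, hC⟩ := hne
  obtain ⟨hx1, hx2⟩ : l1 (rowMarg x) = ∑ q, rowMarg x q ∧ ∑ q, rowMarg x q ≤ 1 := hx.l1_marginal
  obtain ⟨hy1, hy2⟩ : l1 (colMarg y) = ∑ r, colMarg y r ∧ ∑ r, colMarg y r ≤ 1 := hy.l1_marginal
  have hsw := pay_add_pay_le hx hy (GRow_add_GCol_le V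
    (fun q r a b => by rcases hV q r a b with h | h <;> rw [h]; exact zero_le_one) g δ)
  obtain ⟨f, hf⟩ := exists_halfFns_weight hY (colMarg y) hy2
  obtain ⟨f', hf'⟩ := exists_halfFns_weight hX (rowMarg x) hx2
  have hlx := one_sub_sum_le_l1 (rowMarg x)
  have hly := one_sub_sum_le_l1 (colMarg y)
  have hs : 0 < g * δ := mul_pos hg0 hδ0
  have hRf := hR (Sum.inr f)
  have hCf := hC (Sum.inr f')
  rw [rowPay_GRow_inr] at hRf
  rw [colPay_GCol_inr] at hCf
  have hdev : 4 / (1 + 4 * g * δ) * (∑ r with f.1 r = true, colMarg y r +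
      ∑ q with f'.1 q = true, rowMarg x q) ≤ 4 - 8 * (g * δ) := by
    rw [mul_add]
    linarith
  rw [div_mul_eq_mul_div, div_le_iff₀ (by linarith)] at hdev
  constructor <;> nlinarith [sq_nonneg (g * δ)]
end

section
/- Let F = (X,Y,A,B,V) be a free game with |X| and |Y| even, let g, δ > 0, and let (x,y) be a mixed strategy pair of G(F,g,δ) such that x assigns total probability at most gδ to rows outside X×A, y assigns total probability at most gδ to columns outside Y×B, and for every question there is at most one answer played with positive probability (so s_x and s_y are defined). Then the row player's payoff p_r(G,x,y) satisfies |p_r(G,x,y) − p(T_{(x,y)}, s_x, s_y)| ≤ 4gδ, and the column player's payoff p_c(G,x,y) satisfies |p_c(G,x,y) − p(T_{(x,y)}, s_x, s_y)| ≤ 4gδ. -/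
open Finset

/-- A bilinear form with coefficients in `[0, t]`, evaluated at nonnegative vectors of
mass at most `m` and `n`, lies in `[0, t * (m * n)]`. -/
theorem pay_mem_Icc_of_mem_Icc {I J : Type*} [Fintype I] [Fintype J]
    (M : I → J → ℝ) (x : I → ℝ) (y : J → ℝ) (t m n : ℝ)
    (ht : 0 ≤ t) (hM : ∀ i j, M i j ∈ Set.Icc 0 t)
    (hx : ∀ i, 0 ≤ x i) (hy : ∀ j, 0 ≤ y j) (hxm : ∑ i, x i ≤ m) (hyn : ∑ j, y j ≤ n) :
    pay M x y ∈ Set.Icc 0 (t * (m * n)) := by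
  refine ⟨Finset.sum_nonneg fun i _ => Finset.sum_nonneg fun j _ =>
    mul_nonneg (mul_nonneg (hx i) (hM i j).1) (hy j), ?_⟩
  have hx0 : 0 ≤ ∑ i, x i := Finset.sum_nonneg fun i _ => hx i
  have hy0 : 0 ≤ ∑ j, y j := Finset.sum_nonneg fun j _ => hy j
  calc pay M x y ≤ ∑ i, ∑ j, x i * t * y j :=
        Finset.sum_le_sum fun i _ => Finset.sum_le_sum fun j _ =>
          mul_le_mul_of_nonneg_right (mul_le_mul_of_nonneg_left (hM i j).2 (hx i)) (hy j)
    _ = t * ((∑ i, x i) * ∑ j, y j) := by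
        rw [Finset.sum_mul_sum, Finset.mul_sum]
        refine Finset.sum_congr rfl fun i _ => ?_
        rw [Finset.mul_sum]
        exact Finset.sum_congr rfl fun j _ => by ring
    _ ≤ t * (m * n) :=
        mul_le_mul_of_nonneg_left (mul_le_mul hxm hyn hy0 (hx0.trans hxm)) ht

/-- Splitting the expected payoff along the blocks of a game on sum types. -/
theorem pay_sum_type {I I' J J' : Type*} [Fintype I] [Fintype I'] [Fintype J] [Fintype J']
    (M : I ⊕ I' → J ⊕ J' → ℝ) (x : I ⊕ I' → ℝ) (y : J ⊕ J' → ℝ) :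
    pay M x y =
      pay (fun i j => M (.inl i) (.inl j)) (fun i => x (.inl i)) (fun j => y (.inl j)) +
      pay (fun i j => M (.inl i) (.inr j)) (fun i => x (.inl i)) (fun j => y (.inr j)) +
      (pay (fun i j => M (.inr i) (.inl j)) (fun i => x (.inr i)) (fun j => y (.inl j)) +
      pay (fun i j => M (.inr i) (.inr j)) (fun i => x (.inr i)) (fun j => y (.inr j))) := by
  simp only [pay, Fintype.sum_sum_type, Finset.sum_add_distrib]
  ring

theorem pay_neg {I J : Type*} [Fintype I] [Fintype J]
    (M : I → J → ℝ) (x : I → ℝ) (y : J → ℝ) :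
    pay (fun i j => -M i j) x y = -pay M x y := by
  simp [pay]

theorem pay_zero {I J : Type*} [Fintype I] [Fintype J] (x : I → ℝ) (y : J → ℝ) :
    pay (fun _ _ => 0) x y = 0 := by
  simp [pay]

/-- On the question-answer block, the payoff is that of the two-prover game. -/
theorem pay_inl_inl_eq_tpPay {X Y A B H K : Type*}
    [Fintype X] [Fintype Y] [Fintype A] [Fintype B]
    (V : X → Y → A → B → ℝ) (x : X × A ⊕ H → ℝ) (y : Y × B ⊕ K → ℝ)
    (hx : ∀ i, 0 ≤ x i) (hy : ∀ j, 0 ≤ y j) (s₁ : X → A) (s₂ : Y → B)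
    (hs₁ : ∀ q a, 0 < x (Sum.inl (q, a)) → s₁ q = a)
    (hs₂ : ∀ r b, 0 < y (Sum.inl (r, b)) → s₂ r = b) :
    pay (fun (p : X × A) (p' : Y × B) => V p.1 p'.1 p.2 p'.2)
        (fun p => x (.inl p)) (fun p' => y (.inl p')) =
      tpPay V (fun q => ∑ a, x (.inl (q, a))) (fun r => ∑ b, y (.inl (r, b))) s₁ s₂ := by
  have key (q : X) (a : A) (r : Y) (b : B) :
      x (.inl (q, a)) * V q r a b * y (.inl (r, b)) =
        x (.inl (q, a)) * y (.inl (r, b)) * V q r (s₁ q) (s₂ r) := by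
    rcases (hx (.inl (q, a))).eq_or_lt with h | h
    · simp [← h]
    rcases (hy (.inl (r, b))).eq_or_lt with h' | h'
    · simp [← h']
    rw [hs₁ q a h, hs₂ r b h']
    ring
  simp only [pay, tpPay, Fintype.sum_prod_type, key]
  refine Finset.sum_congr rfl fun q _ => ?_
  rw [Finset.sum_comm]
  refine Finset.sum_congr rfl fun r _ => ?_
  simp only [Finset.sum_mul, Finset.mul_sum]
  exact Finset.sum_comm

/-- Lemma 9: if `(x,y)` puts at most `gδ` mass outside the subgame `(R,C)`
and plays at most one answer per question, then for any strategies `s₁, s₂` compatible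
with `(x,y)`, each player's payoff in `G(F,g,δ)` is within `4gδ` of the two-prover
payoff `p(T_{(x,y)}, s₁, s₂)`. -/
theorem payoff_close_to_twoProver {X Y A B : Type*}
    [Fintype X] [Fintype Y] [Fintype A] [Fintype B]
    [DecidableEq X] [DecidableEq Y]
    [Nonempty X] [Nonempty Y] [Nonempty A] [Nonempty B]
    (V : X → Y → A → B → ℝ) (hV : ∀ x y a b, V x y a b = 0 ∨ V x y a b = 1)
    (hX : Even (Fintype.card X)) (hY : Even (Fintype.card Y))
    (g δ : ℝ) (hg0 : 0 < g) (hδ0 : 0 < δ)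
    (x : X × A ⊕ HalfFns Y → ℝ) (y : Y × B ⊕ HalfFns X → ℝ)
    (hx : IsDist x) (hy : IsDist y)
    (hxout : ∑ f : HalfFns Y, x (Sum.inr f) ≤ g * δ)
    (hyout : ∑ f : HalfFns X, y (Sum.inr f) ≤ g * δ)
    (hxu : ∀ q (a₁ a₂ : A), 0 < x (Sum.inl (q, a₁)) → 0 < x (Sum.inl (q, a₂)) → a₁ = a₂)
    (hyu : ∀ r (b₁ b₂ : B), 0 < y (Sum.inl (r, b₁)) → 0 < y (Sum.inl (r, b₂)) → b₁ = b₂) :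
    ∀ (s₁ : X → A) (s₂ : Y → B),
      (∀ q a, 0 < x (Sum.inl (q, a)) → s₁ q = a) →
      (∀ r b, 0 < y (Sum.inl (r, b)) → s₂ r = b) →
      |pay (GRow V g δ) x y - tpPay V (rowMarg x) (colMarg y) s₁ s₂| ≤ 4 * g * δ ∧
      |pay (GCol V g δ) x y - tpPay V (rowMarg x) (colMarg y) s₁ s₂| ≤ 4 * g * δ := by
  intro s₁ s₂ hs₁ hs₂
  have hgδ : 0 < g * δ := mul_pos hg0 hδ0
  have ht0 : 0 ≤ 4 / (1 + 4 * g * δ) := by positivity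
  have ht4 : 4 / (1 + 4 * g * δ) ≤ 4 := div_le_self (by norm_num) (by nlinarith)
  have hxsum := hx.2
  have hysum := hy.2
  rw [Fintype.sum_sum_type] at hxsum hysum
  have hxin : ∑ p : X × A, x (.inl p) ≤ 1 := by
    have : 0 ≤ ∑ f : HalfFns Y, x (.inr f) := Finset.sum_nonneg fun f _ => hx.1 _
    linarith
  have hyin : ∑ p : Y × B, y (.inl p) ≤ 1 := by
    have : 0 ≤ ∑ f : HalfFns X, y (.inr f) := Finset.sum_nonneg fun f _ => hy.1 _
    linarith
  have hite (c : Prop) [Decidable c] :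
      (if c then 4 / (1 + 4 * g * δ) else 0) ∈ Set.Icc (0 : ℝ) 4 := by
    split_ifs
    exacts [⟨ht0, ht4⟩, ⟨le_rfl, by norm_num⟩]
  have hU := pay_mem_Icc_of_mem_Icc
    (fun (f : HalfFns Y) (p : Y × B) => if f.1 p.1 then 4 / (1 + 4 * g * δ) else 0)
    (fun f => x (.inr f)) (fun p => y (.inl p)) 4 (g * δ) 1 (by norm_num)
    (fun _ _ => hite _) (fun _ => hx.1 _) (fun _ => hy.1 _) hxout hyin
  have hW := pay_mem_Icc_of_mem_Icc
    (fun (p : X × A) (f : HalfFns X) => if f.1 p.1 then 4 / (1 + 4 * g * δ) else 0)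
    (fun p => x (.inl p)) (fun f => y (.inr f)) 4 1 (g * δ) (by norm_num)
    (fun _ _ => hite _) (fun _ => hx.1 _) (fun _ => hy.1 _) hxin hyout
  have hT : pay (fun (p : X × A) (p' : Y × B) => V p.1 p'.1 p.2 p'.2)
      (fun p => x (.inl p)) (fun p' => y (.inl p')) =
        tpPay V (rowMarg x) (colMarg y) s₁ s₂ :=
    pay_inl_inl_eq_tpPay V x y hx.1 hy.1 s₁ s₂ hs₁ hs₂
  rw [pay_sum_type (GRow V g δ), pay_sum_type (GCol V g δ)]
  simp only [GRow, GCol, pay_neg, pay_zero, hT]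
  obtain ⟨hU0, hU1⟩ := hU
  obtain ⟨hW0, hW1⟩ := hW
  constructor <;> rw [abs_le] <;> constructor <;> linarith
end

section
/- Let F = (X,Y,A,B,V) be a free game with |X| and |Y| even, let g, δ > 0, and let (x,y) be a mixed strategy pair of G(F,g,δ) whose question marginals satisfy ‖x'‖₁ ≤ 1, ‖y'‖₁ ≤ 1, ‖u_X − x'‖₁ ≤ 16gδ and ‖u_Y − y'‖₁ ≤ 16gδ, where u_X and u_Y are the uniform distributions on X and Y. Then for all strategies s₁ : X → A and s₂ : Y → B, |p(T_{(x,y)}, s₁, s₂) − p(F, s₁, s₂)| ≤ 64gδ. -/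
open Finset

/-- Changing the factors of a product weight changes a double sum of terms bounded by `1` by at most the
`l1` distance of each factor, scaled by the mass of the other. -/
theorem abs_sum_mul_sub_sum_mul_le {I J : Type*} [Fintype I] [Fintype J]
    (p u : I → ℝ) (q v : J → ℝ) (W : I → J → ℝ) (hW : ∀ i j, |W i j| ≤ 1) :
    |∑ i, ∑ j, p i * q j * W i j - ∑ i, ∑ j, u i * v j * W i j| ≤
      l1 (fun i => u i - p i) * l1 q + l1 u * l1 (fun j => v j - q j) := by
  simp only [l1, Finset.sum_mul_sum, ← Finset.sum_sub_distrib, ← Finset.sum_add_distrib]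
  refine (Finset.abs_sum_le_sum_abs _ _).trans (Finset.sum_le_sum fun i _ => ?_)
  refine (Finset.abs_sum_le_sum_abs _ _).trans (Finset.sum_le_sum fun j _ => ?_)
  have h : p i * q j * W i j - u i * v j * W i j =
      -(((u i - p i) * q j + u i * (v j - q j)) * W i j) := by ring
  rw [h, abs_neg, abs_mul]
  refine (mul_le_of_le_one_right (abs_nonneg _) (hW i j)).trans ((abs_add_le _ _).trans ?_)
  rw [abs_mul, abs_mul]

/-- Lemma 10: if the question marginals of `(x,y)` have mass at most `1`
and are within ℓ₁ distance `16gδ` of the uniform distributions, then for all strategies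
the two-prover payoff is within `64gδ` of the free-game payoff. -/
theorem twoProver_close_to_freeGame {X Y A B : Type*}
    [Fintype X] [Fintype Y] [Fintype A] [Fintype B]
    [DecidableEq X] [DecidableEq Y]
    [Nonempty X] [Nonempty Y] [Nonempty A] [Nonempty B]
    (V : X → Y → A → B → ℝ) (hV : ∀ x y a b, V x y a b = 0 ∨ V x y a b = 1)
    (hX : Even (Fintype.card X)) (hY : Even (Fintype.card Y))
    (g δ : ℝ) (hg0 : 0 < g) (hδ0 : 0 < δ)
    (x : X × A ⊕ HalfFns Y → ℝ) (y : Y × B ⊕ HalfFns X → ℝ)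
    (hx : IsDist x) (hy : IsDist y)
    (hxl : l1 (rowMarg x) ≤ 1) (hyl : l1 (colMarg y) ≤ 1)
    (hxu : l1 (fun q => (Fintype.card X : ℝ)⁻¹ - rowMarg x q) ≤ 16 * g * δ)
    (hyu : l1 (fun r => (Fintype.card Y : ℝ)⁻¹ - colMarg y r) ≤ 16 * g * δ) :
    ∀ (s₁ : X → A) (s₂ : Y → B),
      |tpPay V (rowMarg x) (colMarg y) s₁ s₂ - freePayoff V s₁ s₂| ≤ 64 * g * δ := by
  intro s₁ s₂
  have hu : l1 (fun _ : X => (Fintype.card X : ℝ)⁻¹) = 1 := by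
    simp [l1]
  have hfree : freePayoff V s₁ s₂ =
      ∑ q, ∑ r, (Fintype.card X : ℝ)⁻¹ * (Fintype.card Y : ℝ)⁻¹ * V q r (s₁ q) (s₂ r) := by
    simp only [freePayoff, one_div, mul_inv, Finset.mul_sum]
  have hW : ∀ q r, |V q r (s₁ q) (s₂ r)| ≤ 1 := fun q r => by
    rcases hV q r (s₁ q) (s₂ r) with h | h <;> simp [h]
  have key := abs_sum_mul_sub_sum_mul_le (rowMarg x) (fun _ => (Fintype.card X : ℝ)⁻¹)
    (colMarg y) (fun _ => (Fintype.card Y : ℝ)⁻¹) _ hW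
  rw [hu, one_mul] at key
  rw [hfree, tpPay]
  have hnonneg : 0 ≤ l1 (fun q => (Fintype.card X : ℝ)⁻¹ - rowMarg x q) :=
    Finset.sum_nonneg fun _ _ => abs_nonneg _
  have hmul := mul_le_of_le_one_right hnonneg hyl
  have hpos : 0 < g * δ := mul_pos hg0 hδ0
  linarith
end

section
/- Let g ∈ (0,1/4] and δ ∈ (0,1], and let F = (X,Y,A,B,V) be a free game with |X| and |Y| even and ω(F) = 1. Then the rescaled game G_s(F,g,δ) has a ((1−4gδ)/8)-NE in which each player's payoff is 5/8, so its social welfare is 10/8. -/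
open Finset

open Classical in
/-- The mixed strategy that asks a uniformly random question `q` and answers it with `s q`,
never playing the strategies in `H`. -/
noncomputable def questionUniform {Q A : Type*} (H : Type*) [Fintype Q] (s : Q → A) :
    Q × A ⊕ H → ℝ
  | Sum.inl p => if p.2 = s p.1 then 1 / (Fintype.card Q : ℝ) else 0
  | Sum.inr _ => 0

section QuestionUniform

variable {Q A H : Type*} [Fintype Q] [Fintype A] [Fintype H]

theorem sum_questionUniform_mul (s : Q → A) (φ : Q × A ⊕ H → ℝ) :
    ∑ i, questionUniform H s i * φ i = (∑ q, φ (Sum.inl (q, s q))) / Fintype.card Q := by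
  classical
  rw [Fintype.sum_sum_type, Fintype.sum_prod_type]
  simp [questionUniform, ite_mul, div_eq_inv_mul, Finset.mul_sum]

theorem isDist_questionUniform [Nonempty Q] (s : Q → A) : IsDist (questionUniform H s) := by
  refine ⟨?_, ?_⟩
  · rintro (p | h)
    · simp only [questionUniform]
      split_ifs <;> positivity
    · simp [questionUniform]
  · simpa using sum_questionUniform_mul (H := H) s (fun _ => 1)

end QuestionUniform

theorem sum_div_card_eq_of_forall_eq {Q : Type*} [Fintype Q] [Nonempty Q] {φ : Q → ℝ} {c : ℝ}
    (h : ∀ q, φ q = c) : (∑ q, φ q) / Fintype.card Q = c := by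
  simp [h]

theorem sum_div_card_le_of_forall_le {Q : Type*} [Fintype Q] [Nonempty Q] {φ : Q → ℝ} {c : ℝ}
    (h : ∀ q, φ q ≤ c) : (∑ q, φ q) / Fintype.card Q ≤ c := by
  rw [div_le_iff₀ (by positivity), mul_comm]
  simpa using Finset.sum_le_sum fun q (_ : q ∈ Finset.univ) => h q

theorem sum_halfFns_div_card {Q : Type*} [Fintype Q] [Nonempty Q] (f : HalfFns Q) (c : ℝ) :
    (∑ q, ((if f.1 q then c else 0) + 4) / 8) / Fintype.card Q = (c / 2 + 4) / 8 := by
  have hf : 2 * ((Finset.univ.filter fun q => f.1 q = true).card : ℝ) = Fintype.card Q := by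
    exact_mod_cast f.2
  have hQ : (Fintype.card Q : ℝ) ≠ 0 := by simp
  rw [← Finset.sum_div, Finset.sum_add_distrib, ← Finset.sum_filter]
  simp only [Finset.sum_const, nsmul_eq_mul, Finset.card_univ]
  field_simp
  linear_combination c * hf

theorem pay_eq_sum_mul_rowPay {I J : Type*} [Fintype I] [Fintype J] (M : I → J → ℝ) (x : I → ℝ) (y : J → ℝ) :
    pay M x y = ∑ i, x i * rowPay M y i := by
  simp [pay, rowPay, Finset.mul_sum, mul_assoc]

theorem rowPay_questionUniform {I Q B H : Type*} [Fintype Q] [Fintype B] [Fintype H]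
    (M : I → Q × B ⊕ H → ℝ) (s : Q → B) (i : I) :
    rowPay M (questionUniform H s) i = (∑ q, M i (Sum.inl (q, s q))) / Fintype.card Q := by
  rw [← sum_questionUniform_mul (H := H) s (M i)]
  simp only [rowPay, mul_comm]

theorem colPay_questionUniform {J Q A H : Type*} [Fintype Q] [Fintype A] [Fintype H]
    (M : Q × A ⊕ H → J → ℝ) (s : Q → A) (j : J) :
    colPay M (questionUniform H s) j = (∑ q, M (Sum.inl (q, s q)) j) / Fintype.card Q :=
  sum_questionUniform_mul s fun i => M i j

theorem pay_questionUniform_of_forall_eq {X Y A B H K : Type*} [Fintype X] [Fintype Y]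
    [Fintype A] [Fintype B] [Fintype H] [Fintype K] [Nonempty X] [Nonempty Y]
    (M : X × A ⊕ H → Y × B ⊕ K → ℝ) (s₁ : X → A) (s₂ : Y → B) (c : ℝ)
    (h : ∀ q r, M (Sum.inl (q, s₁ q)) (Sum.inl (r, s₂ r)) = c) :
    pay M (questionUniform H s₁) (questionUniform K s₂) = c := by
  rw [pay_eq_sum_mul_rowPay, sum_questionUniform_mul]
  refine sum_div_card_eq_of_forall_eq fun q => ?_
  rw [rowPay_questionUniform]
  exact sum_div_card_eq_of_forall_eq fun r => h q r

theorem exists_forall_eq_one_of_gameValue_eq_one {X Y A B : Type*}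
    [Fintype X] [Fintype Y] [Fintype A] [Fintype B]
    [Nonempty X] [Nonempty Y] [Nonempty A] [Nonempty B]
    (V : X → Y → A → B → ℝ) (hV : ∀ x y a b, V x y a b ≤ 1) (hω : gameValue V = 1) :
    ∃ (s₁ : X → A) (s₂ : Y → B), ∀ x y, V x y (s₁ x) (s₂ y) = 1 := by
  classical
  obtain ⟨⟨s₁, s₂⟩, hs⟩ := exists_eq_ciSup_of_finite
    (f := fun s : (X → A) × (Y → B) => freePayoff V s.1 s.2)
  refine ⟨s₁, s₂, fun x y => ?_⟩
  have h1 : freePayoff V s₁ s₂ = 1 := hs.trans hω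
  have hXY : (Fintype.card X : ℝ) * Fintype.card Y ≠ 0 := by simp
  rw [freePayoff, one_div, inv_mul_eq_one₀ hXY, ← Fintype.sum_prod_type'
    (f := fun x y => V x y (s₁ x) (s₂ y))] at h1
  have h2 : ∑ p : X × Y, V p.1 p.2 (s₁ p.1) (s₂ p.2) = ∑ _p : X × Y, (1 : ℝ) := by
    rw [← h1]
    simp
  exact (Finset.sum_eq_sum_iff_of_le fun p _ => hV p.1 p.2 (s₁ p.1) (s₂ p.2)).1 h2
    (x, y) (Finset.mem_univ _)

theorem half_deviation_gain_le {t : ℝ} (ht0 : 0 ≤ t) (ht1 : t ≤ 1) :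
    (4 / (1 + t) / 2 + 4) / 8 ≤ 5 / 8 + (1 - t) / 8 := by
  have h : 4 / (1 + t) ≤ 4 - 2 * t := by
    rw [div_le_iff₀ (by linarith)]
    nlinarith
  linarith

/-- completeness, rescaled: if `ω(F) = 1`, `g ∈ (0,1/4]`, `δ ∈ (0,1]`,
then the rescaled game `G_s(F,g,δ)` has a `((1-4gδ)/8)`-NE in which each player's
payoff is `5/8` (so its social welfare is `10/8`). -/
theorem completeness_rescaled {X Y A B : Type*}
    [Fintype X] [Fintype Y] [Fintype A] [Fintype B]
    [DecidableEq X] [DecidableEq Y]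
    [Nonempty X] [Nonempty Y] [Nonempty A] [Nonempty B]
    (V : X → Y → A → B → ℝ) (hV : ∀ x y a b, V x y a b = 0 ∨ V x y a b = 1)
    (hX : Even (Fintype.card X)) (hY : Even (Fintype.card Y))
    (g δ : ℝ) (hg0 : 0 < g) (hg : g ≤ 1 / 4) (hδ0 : 0 < δ) (hδ : δ ≤ 1)
    (hω : gameValue V = 1) :
    ∃ (x : X × A ⊕ HalfFns Y → ℝ) (y : Y × B ⊕ HalfFns X → ℝ),
      IsEpsNE (GsRow V g δ) (GsCol V g δ) x y ((1 - 4 * g * δ) / 8) ∧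
      pay (GsRow V g δ) x y = 5 / 8 ∧ pay (GsCol V g δ) x y = 5 / 8 ∧
      sw (GsRow V g δ) (GsCol V g δ) x y = 10 / 8 := by
  have hV1 : ∀ x y a b, V x y a b ≤ 1 := fun x y a b => by
    rcases hV x y a b with h | h <;> norm_num [h]
  obtain ⟨s₁, s₂, hs⟩ := exists_forall_eq_one_of_gameValue_eq_one V hV1 hω
  have ht0 : 0 ≤ 4 * g * δ := by positivity
  have ht1 : 4 * g * δ ≤ 1 := by nlinarith
  have hR : pay (GsRow V g δ) (questionUniform (HalfFns Y) s₁) (questionUniform (HalfFns X) s₂)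
      = 5 / 8 := pay_questionUniform_of_forall_eq _ _ _ _ fun q r => by
    norm_num [GsRow, GRow, hs]
  have hC : pay (GsCol V g δ) (questionUniform (HalfFns Y) s₁) (questionUniform (HalfFns X) s₂)
      = 5 / 8 := pay_questionUniform_of_forall_eq _ _ _ _ fun q r => by
    norm_num [GsCol, GCol, hs]
  have hgain := half_deviation_gain_le ht0 ht1
  refine ⟨_, _, ⟨isDist_questionUniform s₁, isDist_questionUniform s₂, fun i => ?_, fun j => ?_⟩,
    hR, hC, by rw [sw, hR, hC]; norm_num⟩
  · rw [hR, sub_le_iff_le_add', rowPay_questionUniform]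
    rcases i with ⟨q, a⟩ | f
    · refine sum_div_card_le_of_forall_le fun r => ?_
      simp only [GsRow, GRow]
      linarith [hV1 q r a (s₂ r)]
    · exact (sum_halfFns_div_card f _).trans_le hgain
  · rw [hC, sub_le_iff_le_add', colPay_questionUniform]
    rcases j with ⟨r, b⟩ | f
    · refine sum_div_card_le_of_forall_le fun q => ?_
      simp only [GsCol, GCol]
      linarith [hV1 q r (s₁ q) b]
    · exact (sum_halfFns_div_card f _).trans_le hgain
end

section
/- Let g = 1/138, δ* ∈ (0,1] and ε* = (1−4gδ*)/8 (so ε* < 1/8), and let F = (X,Y,A,B,V) be a free game with |X| and |Y| even and ω(F) = 1. Then the game G'(F) has an ε*-WSNE (x,y) such that the support of x is contained in the set X×A of rows of G_s, each player's payoff is 5/8 (so sw(x,y) = 10/8), |supp(x)| = |X|, and max_i x_i ≤ 1/|X|. -/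
open Finset

/-- The mixed strategy that draws a question `q` uniformly and plays `(q, s q)`. -/
noncomputable def graphUniform {Q A H U : Type*} [Fintype Q] (s : Q → A) :
    (Q × A ⊕ H) ⊕ U → ℝ :=
  open Classical in
  Sum.elim (Sum.elim (fun p => if p.2 = s p.1 then (Fintype.card Q : ℝ)⁻¹ else 0)
    (fun _ => 0)) (fun _ => 0)

section GraphUniform

variable {Q A H U : Type*} [Fintype Q]

lemma graphUniform_nonneg (s : Q → A) (i : (Q × A ⊕ H) ⊕ U) : 0 ≤ graphUniform s i := by
  rcases i with (p | _) | _
  · simp only [graphUniform, Sum.elim_inl]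
    split_ifs <;> positivity
  all_goals simp [graphUniform]

lemma graphUniform_le (s : Q → A) (i : (Q × A ⊕ H) ⊕ U) :
    graphUniform s i ≤ (Fintype.card Q : ℝ)⁻¹ := by
  rcases i with (p | _) | _
  · simp only [graphUniform, Sum.elim_inl]
    split_ifs
    · exact le_rfl
    · positivity
  all_goals simp [graphUniform]

lemma graphUniform_pos_iff [Nonempty Q] (s : Q → A) (i : (Q × A ⊕ H) ⊕ U) :
    0 < graphUniform s i ↔ ∃ q, Sum.inl (Sum.inl (q, s q)) = i := by
  rcases i with (⟨q, a⟩ | _) | _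
  · simp only [graphUniform, Sum.elim_inl]
    split_ifs with h
    · simp [← h, Fintype.card_pos]
    · simp only [lt_self_iff_false, Sum.inl.injEq, Prod.mk.injEq, false_iff]
      rintro ⟨_, rfl, rfl⟩
      exact h rfl
  all_goals simp [graphUniform]

variable [Fintype A] [Fintype H] [Fintype U]

lemma sum_mul_graphUniform (s : Q → A) (f : (Q × A ⊕ H) ⊕ U → ℝ) :
    ∑ i, f i * graphUniform s i =
      (Fintype.card Q : ℝ)⁻¹ * ∑ q, f (Sum.inl (Sum.inl (q, s q))) := by
  classical
  simp [graphUniform, Fintype.sum_sum_type, Fintype.sum_prod_type, mul_comm, Finset.mul_sum]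

lemma isDist_graphUniform [Nonempty Q] (s : Q → A) :
    IsDist (graphUniform s : (Q × A ⊕ H) ⊕ U → ℝ) := by
  refine ⟨graphUniform_nonneg s, ?_⟩
  simpa using sum_mul_graphUniform (H := H) (U := U) s (fun _ => 1)

lemma card_graphUniform_pos [Nonempty Q] (s : Q → A)
    [DecidablePred fun i : (Q × A ⊕ H) ⊕ U => 0 < graphUniform s i] :
    (univ.filter fun i : (Q × A ⊕ H) ⊕ U => 0 < graphUniform s i).card = Fintype.card Q := by
  classical
  have hinj : Function.Injective
      (fun q => Sum.inl (Sum.inl (q, s q)) : Q → (Q × A ⊕ H) ⊕ U) := by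
    intro p q h
    simp only [Sum.inl.injEq, Prod.mk.injEq] at h
    exact h.1
  rw [← Finset.card_univ, ← Finset.card_image_of_injective univ hinj]
  congr 1
  ext i
  simp [graphUniform_pos_iff]

lemma rowPay_graphUniform {I : Type*} (M : I → (Q × A ⊕ H) ⊕ U → ℝ) (s : Q → A) (i : I) :
    rowPay M (graphUniform s) i =
      (Fintype.card Q : ℝ)⁻¹ * ∑ q, M i (Sum.inl (Sum.inl (q, s q))) :=
  sum_mul_graphUniform s (M i)

/-- If every pure row in the support of `graphUniform s` earns `c`, so does the mixture. -/
lemma pay_graphUniform {J : Type*} [Fintype J] [Nonempty Q] (M : (Q × A ⊕ H) ⊕ U → J → ℝ)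
    (s : Q → A) (y : J → ℝ) {c : ℝ}
    (h : ∀ q, rowPay M y (Sum.inl (Sum.inl (q, s q))) = c) :
    pay M (graphUniform s) y = c := by
  have : pay M (graphUniform s) y = ∑ i, rowPay M y i * graphUniform s i := by
    simp only [pay, rowPay, Finset.sum_mul]
    exact Finset.sum_congr rfl fun i _ => Finset.sum_congr rfl fun j _ => by ring
  rw [this, sum_mul_graphUniform]
  simp [h]

end GraphUniform

section Bimatrix

variable {I J : Type*}

lemma colPay_eq_rowPay_swap [Fintype I] (M : I → J → ℝ) (x : I → ℝ) (j : J) :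
    colPay M x j = rowPay (fun j i => M i j) x j :=
  Finset.sum_congr rfl fun _ _ => mul_comm _ _

lemma pay_eq_pay_swap [Fintype I] [Fintype J] (M : I → J → ℝ) (x : I → ℝ) (y : J → ℝ) :
    pay M x y = pay (fun j i => M i j) y x := by
  rw [pay, Finset.sum_comm]
  exact Finset.sum_congr rfl fun _ _ => Finset.sum_congr rfl fun _ _ => by ring

end Bimatrix

section GGame

variable {X Y A B : Type*} [Fintype X] [Fintype Y]

lemma G'Col_swap (V : X → Y → A → B → ℝ) (g δ : ℝ) :
    (fun j i => G'Col V g δ i j) = G'Row (fun y x b a => V x y a b) g δ := by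
  funext j i
  rcases j with (_ | _) | _ <;> rcases i with (_ | _) | _ <;> rfl

variable [Fintype B] [DecidableEq X]

lemma rowPay_G'Row_eq [Nonempty Y] (V : X → Y → A → B → ℝ) (g δ : ℝ) (s₂ : Y → B) {q : X} {a : A}
    (hs : ∀ r, V q r a (s₂ r) = 1) :
    rowPay (G'Row V g δ) (graphUniform s₂) (Sum.inl (Sum.inl (q, a))) = 5 / 8 := by
  rw [rowPay_graphUniform]
  simp only [G'Row, GsRow, GRow, hs]
  simp
  norm_num

lemma rowPay_G'Row_le [Nonempty Y] (V : X → Y → A → B → ℝ) (hV : ∀ x y a b, V x y a b ≤ 1)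
    (g δ : ℝ) (h0 : 0 ≤ 4 * g * δ) (h1 : 4 * g * δ ≤ 1) (s₂ : Y → B)
    (k : (X × A ⊕ HalfFns Y) ⊕ Unit) :
    rowPay (G'Row V g δ) (graphUniform s₂) k ≤ 5 / 8 + (1 - 4 * g * δ) / 8 := by
  have hc : (0 : ℝ) < Fintype.card Y := by exact_mod_cast Fintype.card_pos
  rw [rowPay_graphUniform, inv_mul_le_iff₀ hc]
  rcases k with (⟨q, a⟩ | f) | _
  · refine (Finset.sum_le_card_nsmul _ _ _ fun r _ => ?_).trans_eq (nsmul_eq_mul _ _)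
    have := hV q r a (s₂ r)
    simp only [G'Row, GsRow, GRow]
    linarith
  · have hf : (2 : ℝ) * (univ.filter fun r => f.1 r = true).card = Fintype.card Y := by
      exact_mod_cast f.2
    have ht : 2 / (1 + 4 * g * δ) ≤ 2 - 4 * g * δ := by
      rw [div_le_iff₀ (by linarith)]
      nlinarith
    have hsum : ∑ r, G'Row V g δ (Sum.inl (Sum.inr f)) (Sum.inl (Sum.inl (r, s₂ r))) =
        Fintype.card Y * ((2 / (1 + 4 * g * δ) + 4) / 8) := by
      simp only [G'Row, GsRow, GRow]
      rw [← Finset.sum_div, Finset.sum_add_distrib, ← Finset.sum_filter]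
      simp only [Finset.sum_const, Finset.card_univ, nsmul_eq_mul]
      rw [← hf]
      ring
    rw [hsum]
    gcongr
    linarith
  · simp [G'Row, mul_add]

end GGame

/-- A free game of value one has a strategy pair that wins on every pair of questions. -/
lemma exists_perfect_strategies_of_gameValue_eq_one {X Y A B : Type*}
    [Fintype X] [Fintype Y] [Fintype A] [Fintype B]
    [Nonempty X] [Nonempty Y] [Nonempty A] [Nonempty B]
    (V : X → Y → A → B → ℝ) (hV : ∀ x y a b, V x y a b ≤ 1) (hω : gameValue V = 1) :
    ∃ (s₁ : X → A) (s₂ : Y → B), ∀ q r, V q r (s₁ q) (s₂ r) = 1 := by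
  obtain ⟨⟨s₁, s₂⟩, hs⟩ := exists_eq_ciSup_of_finite
    (f := fun s : (X → A) × (Y → B) => freePayoff V s.1 s.2)
  have hp : freePayoff V s₁ s₂ = 1 := hs.trans hω
  refine ⟨s₁, s₂, fun q r => ?_⟩
  have hc : (0 : ℝ) < Fintype.card X * Fintype.card Y := by
    exact_mod_cast Nat.mul_pos Fintype.card_pos Fintype.card_pos
  rw [freePayoff, one_div, inv_mul_eq_iff_eq_mul₀ hc.ne', mul_one] at hp
  have hsum : ∑ p : X × Y, V p.1 p.2 (s₁ p.1) (s₂ p.2) = ∑ _p : X × Y, (1 : ℝ) := by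
    rw [Fintype.sum_prod_type, hp]
    simp
  exact (Finset.sum_eq_sum_iff_of_le fun p _ => hV _ _ _ _).1 hsum (q, r) (mem_univ _)

open Classical in
/-- Lemma 12: with `g = 1/138`, `ε* = (1-4gδ*)/8`, if `ω(F) = 1` then
`G'(F)` has an `ε*`-WSNE supported on the rows `X × A` of `G_s`, with payoffs `5/8`
(social welfare `10/8`), support size `|X|`, and maximum probability `1/|X|`. -/
theorem Gprime_WSNE_of_value_one {X Y A B : Type*}
    [Fintype X] [Fintype Y] [Fintype A] [Fintype B]
    [DecidableEq X] [DecidableEq Y]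
    [Nonempty X] [Nonempty Y] [Nonempty A] [Nonempty B]
    (V : X → Y → A → B → ℝ) (hV : ∀ x y a b, V x y a b = 0 ∨ V x y a b = 1)
    (hX : Even (Fintype.card X)) (hY : Even (Fintype.card Y))
    (g δ ε : ℝ) (hg : g = 1 / 138) (hδ0 : 0 < δ) (hδ : δ ≤ 1)
    (hε : ε = (1 - 4 * g * δ) / 8)
    (hω : gameValue V = 1) :
    ∃ (x : (X × A ⊕ HalfFns Y) ⊕ Unit → ℝ) (y : (Y × B ⊕ HalfFns X) ⊕ Unit → ℝ),
      IsEpsWSNE (G'Row V g δ) (G'Col V g δ) x y ε ∧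
      (∀ i, 0 < x i → ∃ p : X × A, i = Sum.inl (Sum.inl p)) ∧
      pay (G'Row V g δ) x y = 5 / 8 ∧ pay (G'Col V g δ) x y = 5 / 8 ∧
      sw (G'Row V g δ) (G'Col V g δ) x y = 10 / 8 ∧
      (Finset.univ.filter (fun i => 0 < x i)).card = Fintype.card X ∧
      (∀ i, x i ≤ (Fintype.card X : ℝ)⁻¹) := by
  have hV1 : ∀ x y a b, V x y a b ≤ 1 := fun x y a b => by
    rcases hV x y a b with h | h <;> simp [h]
  obtain ⟨s₁, s₂, hs⟩ := exists_perfect_strategies_of_gameValue_eq_one V hV1 hω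
  have h0 : 0 ≤ 4 * g * δ := by subst hg; positivity
  have h1 : 4 * g * δ ≤ 1 := by subst hg; linarith
  have hrow : ∀ q, rowPay (G'Row V g δ) (graphUniform s₂) (Sum.inl (Sum.inl (q, s₁ q))) = 5 / 8 :=
    fun q => rowPay_G'Row_eq V g δ s₂ (hs q)
  have hcol : ∀ r, rowPay (G'Row (fun y x b a => V x y a b) g δ) (graphUniform s₁)
      (Sum.inl (Sum.inl (r, s₂ r))) = 5 / 8 :=
    fun r => rowPay_G'Row_eq _ g δ s₁ fun q => hs q r
  have hpayR := pay_graphUniform _ s₁ (graphUniform s₂) hrow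
  have hpayC : pay (G'Col V g δ) (graphUniform s₁) (graphUniform s₂) = 5 / 8 := by
    rw [pay_eq_pay_swap, G'Col_swap]
    exact pay_graphUniform _ s₂ (graphUniform s₁) hcol
  refine ⟨graphUniform s₁, graphUniform s₂,
    ⟨isDist_graphUniform s₁, isDist_graphUniform s₂, fun i hi k => ?_, fun j hj k => ?_⟩,
    fun i hi => ?_, hpayR, hpayC, ?_, card_graphUniform_pos s₁, graphUniform_le s₁⟩
  · obtain ⟨q, rfl⟩ := (graphUniform_pos_iff s₁ i).1 hi
    have := rowPay_G'Row_le V hV1 g δ h0 h1 s₂ k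
    rw [hrow, hε]
    linarith
  · obtain ⟨r, rfl⟩ := (graphUniform_pos_iff s₂ j).1 hj
    have := rowPay_G'Row_le (fun y x b a => V x y a b) (fun y x b a => hV1 x y a b) g δ h0 h1 s₁ k
    rw [colPay_eq_rowPay_swap, colPay_eq_rowPay_swap, G'Col_swap, hcol, hε]
    linarith
  · obtain ⟨q, rfl⟩ := (graphUniform_pos_iff s₁ i).1 hi
    exact ⟨_, rfl⟩
  · rw [sw, hpayR, hpayC]
    norm_num
end
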